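/- Let I, J, I', J' be k-element subsets of {1, …, n}, and let X = (h_{μ_i − ν_j})_{i,j=1}^n be a generalized Jacobi–Trudi matrix (for partitions μ, ν with at most n parts). Then Δ_{I∨I', J∨J'}(X)·Δ_{I∧I', J∧J'}(X) − Δ_{I,J}(X)·Δ_{I',J'}(X) is Schur nonnegative. -/

import Mathlib

/-- The complete homogeneous symmetric function `h_m` in `N` variables,
with `h_m = 0` for `m < 0`. -/
noncomputable def homog (N : ℕ) (m : ℤ) : MvPolynomial (Fin N) ℤ :=
  if 0 ≤ m then MvPolynomial.hsymm (Fin N) ℤ m.toNat else 0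

/-- The skew Schur polynomial `s_{λ/μ}` in `N` variables, given by the
Jacobi–Trudi determinant `det (h_{λ_i - μ_j - i + j})_{i,j=1}^k`, where the
partitions `lam`, `mu` are recorded 0-indexed (`lam 0 = λ_1`). -/
noncomputable def skewSchur (N k : ℕ) (lam mu : ℕ → ℕ) : MvPolynomial (Fin N) ℤ :=
  Matrix.det (Matrix.of fun i j : Fin k =>
    homog N ((lam i : ℤ) - (mu j : ℤ) - (i : ℤ) + (j : ℤ)))

/-- A symmetric polynomial is Schur nonnegative if it is a linear combination
with nonnegative coefficients of Schur polynomials `s_λ`. -/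
def IsSchurNonneg (N : ℕ) (f : MvPolynomial (Fin N) ℤ) : Prop :=
  ∃ (m : ℕ) (c : Fin m → ℕ) (k : Fin m → ℕ) (lam : Fin m → ℕ → ℕ),
    (∀ i, Antitone (lam i)) ∧ (∀ i j, k i ≤ j → lam i j = 0) ∧
    f = ∑ i, (c i : ℤ) • skewSchur N (k i) (lam i) (fun _ => 0)

/-- The minor `Δ_{I,J}(X)` of the generalized Jacobi–Trudi matrix
`X = (h_{μ_i - ν_j})_{i,j=1}^n` (partitions recorded 0-indexed), with row set
enumerated in increasing order by `r : Fin k → Fin n` and column set by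
`c : Fin k → Fin n`. -/
noncomputable def jtMinor (N n : ℕ) (mu nu : ℕ → ℕ) (k : ℕ)
    (r c : Fin k → Fin n) : MvPolynomial (Fin N) ℤ :=
  Matrix.det (Matrix.of fun a b : Fin k => homog N ((mu (r a) : ℤ) - (nu (c b) : ℤ)))


namespace JT

/-- number of entries at least `x` -/
def cnt {k : ℕ} (K : Fin k → ℤ) (x : ℤ) : ℤ := ∑ a, if x ≤ K a then 1 else 0

/-- sum of positive parts -/
def pos {k : ℕ} (K : Fin k → ℤ) (y : ℤ) : ℤ := ∑ a, max (K a - y) 0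

/-- interlacing of two consecutive rows -/
def Inter {k : ℕ} (β γ : Fin k → ℤ) : Prop :=
  (∀ a, β a ≤ γ a) ∧ (∀ a b, a < b → γ a < β b)

lemma Inter.refl {k : ℕ} {K : Fin k → ℤ} (h : StrictMono K) : Inter K K :=
  ⟨fun _ => le_rfl, fun _ _ hab => h hab⟩

lemma pos_sub {k : ℕ} (K : Fin k → ℤ) (y : ℤ) : pos K (y - 1) = pos K y + cnt K y := by
  unfold pos cnt
  rw [← Finset.sum_add_distrib]
  refine Finset.sum_congr rfl fun a _ => ?_
  split_ifs <;> omega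

lemma cnt_eq_card {k : ℕ} (K : Fin k → ℤ) (x : ℤ) :
    cnt K x = ((Finset.univ.filter fun a => x ≤ K a).card : ℤ) := by
  unfold cnt
  rw [Finset.card_filter]
  push_cast
  rfl

lemma cnt_le {k : ℕ} {α β : Fin k → ℤ} (h : Inter α β) (x : ℤ) : cnt α x ≤ cnt β x := by
  refine Finset.sum_le_sum fun a _ => ?_
  have := h.1 a
  split_ifs <;> omega

lemma cnt_le' {k : ℕ} {α β : Fin k → ℤ} (h : Inter α β) (x : ℤ) :
    cnt β x ≤ cnt α (x + 1) + 1 := by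
  rw [cnt_eq_card, cnt_eq_card]
  rcases (Finset.univ.filter fun a => x ≤ β a).eq_empty_or_nonempty with h0 | h0
  · rw [h0]; simp; positivity
  · set a0 := (Finset.univ.filter fun a => x ≤ β a).min' h0 with ha0
    have hs : (Finset.univ.filter fun a => x ≤ β a) ⊆
        insert a0 (Finset.univ.filter fun a => x + 1 ≤ α a) := by
      intro a ha
      rw [Finset.mem_insert, Finset.mem_filter]
      have h1 := Finset.min'_le _ a ha
      rcases h1.eq_or_lt with h2 | h2
      · exact Or.inl h2.symm
      · right
        have h3 := h.2 _ _ h2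
        have h4 := Finset.min'_mem _ h0
        rw [Finset.mem_filter] at h4
        exact ⟨Finset.mem_univ _, by omega⟩
    have := (Finset.card_le_card hs).trans (Finset.card_insert_le _ _)
    exact_mod_cast this

lemma cnt_anti {k : ℕ} (K : Fin k → ℤ) {x y : ℤ} (h : x ≤ y) : cnt K y ≤ cnt K x := by
  refine Finset.sum_le_sum fun a _ => ?_
  split_ifs <;> omega

lemma cnt_eq_zero {k : ℕ} (K : Fin k → ℤ) {x : ℤ} (h : ∀ a, K a < x) : cnt K x = 0 := by
  refine Finset.sum_eq_zero fun a _ => ?_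
  have := h a
  split_ifs <;> omega

lemma cnt_eq_k {k : ℕ} (K : Fin k → ℤ) {x : ℤ} (h : ∀ a, x ≤ K a) : cnt K x = k := by
  unfold cnt
  rw [Finset.sum_congr rfl (fun a _ => if_pos (h a))]
  simp

lemma pos_eq_zero {k : ℕ} (K : Fin k → ℤ) {x : ℤ} (h : ∀ a, K a ≤ x) : pos K x = 0 := by
  refine Finset.sum_eq_zero fun a _ => ?_
  have := h a
  omega

lemma pos_eq_sum {k : ℕ} (K : Fin k → ℤ) {x : ℤ} (h : ∀ a, x ≤ K a) :
    pos K x = ∑ a, K a - k * x := by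
  unfold pos
  rw [Finset.sum_congr rfl (fun a _ => max_eq_left (sub_nonneg.2 (h a)))]
  simp

/-- `pos` at `y` is determined by the `cnt`s above `y`. -/
lemma pos_congr {k : ℕ} (K K' : Fin k → ℤ) (z : ℤ) (h : ∀ x, z < x → cnt K x = cnt K' x) :
    ∀ y, z ≤ y → pos K y = pos K' y := by
  obtain ⟨M, hM⟩ : ∃ M : ℤ, ∀ a, K a ≤ M ∧ K' a ≤ M := by
    refine ⟨∑ a, |K a| + ∑ a, |K' a|, fun a => ?_⟩
    have h1 := Finset.single_le_sum (f := fun a => |K a|) (fun i _ => abs_nonneg _)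
      (Finset.mem_univ a)
    have h2 := Finset.single_le_sum (f := fun a => |K' a|) (fun i _ => abs_nonneg _)
      (Finset.mem_univ a)
    have h3 := le_abs_self (K a)
    have h4 := le_abs_self (K' a)
    have h5 := abs_nonneg (K a)
    have h6 := abs_nonneg (K' a)
    constructor <;> linarith
  have key : ∀ n : ℕ, ∀ y, z ≤ y → M ≤ y + n → pos K y = pos K' y := by
    intro n
    induction n with
    | zero =>
      intro y _ hy
      rw [pos_eq_zero K fun a => by have := (hM a).1; push_cast at hy; omega,
        pos_eq_zero K' fun a => by have := (hM a).2; push_cast at hy; omega]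
    | succ n ih =>
      intro y hz hy
      have h1 := pos_sub K (y + 1)
      have h2 := pos_sub K' (y + 1)
      rw [add_sub_cancel_right] at h1 h2
      rw [h1, h2, ih (y + 1) (by omega) (by push_cast at hy; omega), h (y + 1) (by omega)]
  intro y hz
  exact key (M - y).toNat y hz (by omega)

/-! Local analysis of one level -/

/-- The data of counting functions at one level, for both colours. -/
structure Loc (a b g : Bool → ℤ → ℤ) (A : ℤ → ℤ) : Prop where
  ab : ∀ c x, a c x ≤ b c x
  ab' : ∀ c x, b c x ≤ a c (x + 1) + 1
  bg : ∀ c x, b c x ≤ g c x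
  bg' : ∀ c x, g c x ≤ b c (x + 1) + 1
  sa : ∀ c x, a c (x + 1) ≤ a c x
  sa' : ∀ c x, a c x ≤ a c (x + 1) + 1
  sb : ∀ c x, b c (x + 1) ≤ b c x
  sb' : ∀ c x, b c x ≤ b c (x + 1) + 1
  sg : ∀ c x, g c (x + 1) ≤ g c x
  sg' : ∀ c x, g c x ≤ g c (x + 1) + 1
  hA : ∀ y, A y = A (y + 1) + (b true (y + 1) - a true (y + 1) + (b false (y + 1) - a false (y + 1)))
    - (g true (y + 1) - b true (y + 1) + (g false (y + 1) - b false (y + 1)))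
  top : ∃ M, ∀ x, M ≤ x → A x = 0 ∧ ∀ c, g c x = 0 ∧ b c x = 0 ∧ a c x = 0

def N1 (a b : Bool → ℤ → ℤ) (y : ℤ) : ℤ := b true y - a true y + (b false y - a false y)

def DB (a b g : Bool → ℤ → ℤ) (A : ℤ → ℤ) (y : ℤ) : Prop :=
  A y = 0 ∧ N1 a b y + N1 b g y = 2 ∧ g true (y - 1) + g false (y - 1) = g true y + g false y ∧
    N1 a b (y + 1) = 0

def CT (a b g : Bool → ℤ → ℤ) (A : ℤ → ℤ) (y : ℤ) : Prop :=
  A y = 0 ∧ N1 a b y = 1 ∧ N1 b g y = 1 ∧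
    g true (y - 1) + g false (y - 1) = g true y + g false y

def Pass (a b g : Bool → ℤ → ℤ) (A : ℤ → ℤ) (y : ℤ) (c : Bool) : Prop :=
  (DB a b g A y → g c y = b c y) ∧ (¬ DB a b g A y → N1 b g y ≤ A y ∨ CT a b g A y)

section
variable {a b g : Bool → ℤ → ℤ} {A : ℤ → ℤ}

lemma pass_of_le (H : Loc a b g A) {y : ℤ} (h : N1 b g y ≤ A y) (c : Bool) :
    Pass a b g A y c := by
  refine ⟨fun hd => ?_, fun _ => Or.inl h⟩
  have h1 := hd.1
  have := H.bg true y
  have := H.bg false y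
  unfold N1 at h
  cases c <;> omega

lemma pass_P (H : Loc a b g A) {y : ℤ} {c : Bool} (h : Pass a b g A (y + 1) c) :
    N1 a b (y + 1) ≤ A y ∨ (A (y + 1) = 0 ∧ N1 a b (y + 1) = 1 ∧ N1 b g (y + 1) = 1 ∧
      g true y + g false y = g true (y + 1) + g false (y + 1) ∧ A y = 0) := by
  have hA := H.hA y
  by_cases hd : DB a b g A (y + 1)
  · have h1 := h.1 hd
    obtain ⟨d1, d2, d3, d4⟩ := hd
    rw [add_sub_cancel_right] at d3
    have := H.bg true (y + 1)
    have := H.bg false (y + 1)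
    have := H.bg' true (y + 1)
    have := H.bg' false (y + 1)
    have := H.sb true (y + 1)
    have := H.sb false (y + 1)
    unfold N1 at *
    cases c <;> omega
  · rcases h.2 hd with h1 | ⟨d1, d2, d3, d4⟩
    · left; unfold N1 at *; omega
    · rw [add_sub_cancel_right] at d4
      right; unfold N1 at *; omega

lemma A_nonneg (H : Loc a b g A) {y : ℤ} {c : Bool} (h : Pass a b g A (y + 1) c) : 0 ≤ A y := by
  have := H.ab true (y + 1)
  have := H.ab false (y + 1)
  have := pass_P H h
  unfold N1 at *
  omega

lemma Lstar (H : Loc a b g A) {y : ℤ} (hp : ∀ y', y < y' → ∃ c, Pass a b g A y' c) {X : Bool}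
    (h2 : g X y = b X y + 1) (h1 : b X (y + 1) = a X (y + 1) + 1) : 1 ≤ A y := by
  obtain ⟨M, hM⟩ := H.top
  have key : ∀ n : ℕ, ∀ y, (∀ y', y < y' → ∃ c, Pass a b g A y' c) → M ≤ y + n →
      g X y = b X y + 1 → b X (y + 1) = a X (y + 1) + 1 → 1 ≤ A y := by
    intro n
    induction n with
    | zero =>
      intro y _ hy h2 _
      have := (hM y (by simpa using hy)).2 X
      omega
    | succ n ih =>
      intro y hp hy h2 h1
      obtain ⟨c, hc⟩ := hp (y + 1) (by omega)
      have := H.ab true (y + 1)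
      have := H.ab false (y + 1)
      rcases pass_P H hc with h | ⟨q1, q2, q3, q4, q5⟩
      · unfold N1 at h; cases X <;> omega
      · have := ih (y + 1) (fun y' hy' => hp y' (by omega)) (by push_cast at hy; omega)
        have := H.sg true y
        have := H.sg false y
        have := H.sb X y
        have := H.bg X (y + 1)
        have := H.bg' X y
        have := H.bg' X (y + 1)
        have := H.ab' X (y + 1)
        have := H.ab X (y + 1 + 1)
        have := H.sa X (y + 1)
        have := H.sb X (y + 1)
        have := H.bg X (y + 1 + 1)
        have := H.sg' X (y + 1)
        have := H.ab' X (y + 1)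
        cases X <;> omega
  exact key (M - y).toNat y hp (by omega) h2 h1

lemma fail_nonDB (H : Loc a b g A) {y : ℤ} (hp : ∀ y', y < y' → ∃ c, Pass a b g A y' c)
    (hd : ¬ DB a b g A y) (hf : ¬ (N1 b g y ≤ A y)) (hc : ¬ CT a b g A y) :
    A y - N1 b g y = -1 ∧ ∀ c, 1 ≤ b c y - a c y → 1 ≤ g c (y - 1) - b c (y - 1) := by
  have F : ∀ X, (0 ≤ b X y - a X y ∧ b X y - a X y ≤ 1) ∧ (0 ≤ g X y - b X y ∧ g X y - b X y ≤ 1) ∧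
      (0 ≤ b X (y + 1) - a X (y + 1) ∧ b X (y + 1) - a X (y + 1) ≤ 1) ∧
      (0 ≤ g X (y + 1) - b X (y + 1) ∧ g X (y + 1) - b X (y + 1) ≤ 1) ∧
      (b X y - a X y = 1 → g X y - b X y = 1 → b X (y + 1) - a X (y + 1) = 1) ∧
      (b X y - a X y = 1 → g X y - b X y = 1 → 1 ≤ g X (y - 1) - b X (y - 1)) ∧
      (g X y - b X y = 1 → g X (y - 1) - g X y = 0) ∧
      (b X y - a X y = 1 → g X (y - 1) - g X y = 1 → 1 ≤ g X (y - 1) - b X (y - 1)) ∧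
      (g X y - b X y = 1 → g X y - g X (y + 1) = 0 → g X (y + 1) - b X (y + 1) = 1) ∧
      (0 ≤ g X (y - 1) - g X y ∧ g X (y - 1) - g X y ≤ 1) ∧
      (0 ≤ g X y - g X (y + 1) ∧ g X y - g X (y + 1) ≤ 1) ∧
      (g X y - b X y = 1 → b X (y + 1) - a X (y + 1) = 1 → 1 ≤ A y) := by
    intro X
    have e : y - 1 + 1 = y := by ring
    have := H.ab X y
    have := H.ab' X y
    have := H.bg X y
    have := H.bg' X y
    have := H.sa X y
    have := H.sb X y
    have := H.sg X y
    have := H.sg' X y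
    have := H.ab X (y + 1)
    have := H.ab' X (y + 1)
    have := H.bg X (y + 1)
    have := H.bg' X (y + 1)
    have := H.sa X (y + 1)
    have := H.sb X (y + 1)
    have := H.sg X (y - 1)
    have := H.sg' X (y - 1)
    have := H.sb X (y - 1)
    have := H.ab X (y - 1)
    have := H.bg X (y - 1)
    have := H.bg' X (y - 1)
    have := H.ab' X (y - 1)
    rw [e] at *
    refine ⟨by omega, by omega, by omega, by omega, by omega, by omega, by omega, by omega,
      by omega, by omega, by omega, fun h1 h2 => Lstar H hp (X := X) (by omega) (by omega)⟩
  have P : N1 a b (y + 1) ≤ A y ∨ (A (y + 1) = 0 ∧ N1 a b (y + 1) = 1 ∧ N1 b g (y + 1) = 1 ∧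
      g true y + g false y = g true (y + 1) + g false (y + 1) ∧ A y = 0) := by
    obtain ⟨c, hc⟩ := hp (y + 1) (by omega)
    exact pass_P H hc
  have F1 := F true
  have F2 := F false
  clear F hp
  have hd' : ¬ (A y = 0 ∧ N1 a b y + N1 b g y = 2 ∧ (g true (y - 1) - g true y) + (g false (y - 1) - g false y) = 0 ∧
    N1 a b (y + 1) = 0) := fun h => hd ⟨h.1, h.2.1, by omega, h.2.2.2⟩
  have hc' : ¬ (A y = 0 ∧ N1 a b y = 1 ∧ N1 b g y = 1 ∧ (g true (y - 1) - g true y) + (g false (y - 1) - g false y) = 0) :=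
    fun h => hc ⟨h.1, h.2.1, h.2.2.1, by omega⟩
  have P' : N1 a b (y + 1) ≤ A y ∨ (N1 a b (y + 1) = 1 ∧ N1 b g (y + 1) = 1 ∧
      (g true y - g true (y + 1)) + (g false y - g false (y + 1)) = 0 ∧ A y = 0) := by
    rcases P with h | h
    · exact Or.inl h
    · right; exact ⟨h.2.1, h.2.2.1, by omega, h.2.2.2.2⟩
  clear hd hc P
  unfold N1 at *
  rw [Bool.forall_bool]
  generalize b true y - a true y = p1 at *
  generalize b false y - a false y = p2 at *
  generalize g true y - b true y = q1 at *
  generalize g false y - b false y = q2 at *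
  generalize b true (y + 1) - a true (y + 1) = p1' at *
  generalize b false (y + 1) - a false (y + 1) = p2' at *
  generalize g true (y + 1) - b true (y + 1) = q1' at *
  generalize g false (y + 1) - b false (y + 1) = q2' at *
  generalize g true (y - 1) - b true (y - 1) = r1 at *
  generalize g false (y - 1) - b false (y - 1) = r2 at *
  generalize g true (y - 1) - g true y = s1 at *
  generalize g false (y - 1) - g false y = s2 at *
  generalize g true y - g true (y + 1) = t1 at *
  generalize g false y - g false (y + 1) = t2 at *
  generalize A y = z at *
  clear H
  obtain ⟨⟨h1, h2⟩, ⟨h3, h4⟩, ⟨h5, h6⟩, ⟨h7, h8⟩, f1, f2, f3, f4, f5, ⟨h9, h10⟩, ⟨h11, h12⟩, f6⟩ := F1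
  obtain ⟨⟨g1, g2⟩, ⟨g3, g4⟩, ⟨g5, g6⟩, ⟨g7, g8⟩, e1, e2, e3, e4, e5, ⟨g9, g10⟩, ⟨g11, g12⟩, e6⟩ := F2
  interval_cases p1 <;> interval_cases q1 <;> interval_cases p2 <;> interval_cases q2 <;>
    simp only [true_implies, zero_ne_one, false_implies] at * <;> omega

lemma f6 {α β γ δ : ℤ → ℤ} {y : ℤ} (h1 : β y = α y + 1) (h2 : β (y + 1) = α (y + 1))
    (h3 : δ y = γ y + 1) (s1 : β y ≤ α (y + 1) + 1) (s2 : α (y + 1) ≤ α y)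
    (s4 : β y ≤ γ y) (s5 : δ y ≤ γ (y + 1) + 1) (s7 : γ (y + 1) ≤ β (y + 1) + 1)  :
    γ (y + 1) = β (y + 1) + 1 := by
  omega
end

end JT

namespace JT

def bkL {k : ℕ} (α γ : Fin (k + 1) → ℤ) : Fin (k + 1) → ℤ :=
  Fin.cons (α 0) (fun a => max (α a.succ) (γ a.castSucc + 1))

def bkR {k : ℕ} (α γ : Fin (k + 1) → ℤ) : Fin (k + 1) → ℤ :=
  Fin.snoc (α := fun _ => ℤ) (fun a => min (γ a.castSucc) (α a.succ - 1)) (γ (Fin.last k))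

/-- truncated Bender-Knuth move -/
def bk {k : ℕ} (α β γ : Fin (k + 1) → ℤ) (z : ℤ) : Fin (k + 1) → ℤ :=
  fun a => if β a ≤ z then bkL α γ a + min (bkR α γ a) z - β a else β a

section
variable {k : ℕ} {α β γ : Fin (k + 1) → ℤ}

@[simp] lemma bkL_zero : bkL α γ 0 = α 0 := rfl
@[simp] lemma bkL_succ (a : Fin k) : bkL α γ a.succ = max (α a.succ) (γ a.castSucc + 1) := rfl
@[simp] lemma bkR_last : bkR α γ (Fin.last k) = γ (Fin.last k) := by simp [bkR]
@[simp] lemma bkR_castSucc (a : Fin k) :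
    bkR α γ a.castSucc = min (γ a.castSucc) (α a.succ - 1) := by simp [bkR]

lemma bkL_le (h1 : Inter α β) (h2 : Inter β γ) (a : Fin (k + 1)) : bkL α γ a ≤ β a := by
  refine Fin.cases ?_ (fun a => ?_) a
  · exact h1.1 0
  · rw [bkL_succ]
    have := h1.1 a.succ
    have := h2.2 a.castSucc a.succ (Fin.castSucc_lt_succ)
    omega

lemma le_bkR (h1 : Inter α β) (h2 : Inter β γ) (a : Fin (k + 1)) : β a ≤ bkR α γ a := by
  refine Fin.lastCases ?_ (fun a => ?_) a
  · rw [bkR_last]; exact h2.1 _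
  · rw [bkR_castSucc]
    have := h2.1 a.castSucc
    have := h1.2 a.castSucc a.succ (Fin.castSucc_lt_succ)
    omega

lemma inter_of_LR (hα : StrictMono α) (hγ : StrictMono γ) (hL : ∀ a, bkL α γ a ≤ β a)
    (hR : ∀ a, β a ≤ bkR α γ a) : Inter α β ∧ Inter β γ ∧ StrictMono β := by
  have A1 : ∀ a, α a ≤ β a := by
    intro a
    have := hL a
    revert this
    refine Fin.cases ?_ (fun a => ?_) a
    · exact id
    · rw [bkL_succ]; omega
  have A2 : ∀ a, β a ≤ γ a := by
    intro a
    have := hR a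
    revert this
    refine Fin.lastCases ?_ (fun a => ?_) a
    · rw [bkR_last]; exact id
    · rw [bkR_castSucc]; omega
  have A3 : ∀ a b, a < b → β a < α b := by
    intro a b
    have := hR a
    revert this
    refine Fin.lastCases ?_ (fun a => ?_) a
    · intro _ h
      exact absurd (Fin.le_last b) (not_le.2 h)
    · rw [bkR_castSucc]
      intro h hab
      have : α a.succ ≤ α b := hα.monotone (Fin.castSucc_lt_iff_succ_le.1 hab)
      omega
  have A4 : ∀ a b, a < b → γ a < β b := by
    intro a b
    have := hL b
    revert this
    refine Fin.cases ?_ (fun b => ?_) b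
    · intro _ h
      exact absurd (Fin.zero_le a) (not_le.2 h)
    · rw [bkL_succ]
      intro h hab
      have : γ a ≤ γ b.castSucc := hγ.monotone (Fin.le_castSucc_iff.2 hab)
      omega
  exact ⟨⟨A1, A3⟩, ⟨A2, A4⟩, fun a b hab => (A2 a).trans_lt (A4 a b hab)⟩

lemma bk_mem (h1 : Inter α β) (h2 : Inter β γ) (z : ℤ) (a : Fin (k + 1)) :
    bkL α γ a ≤ bk α β γ z a ∧ bk α β γ z a ≤ bkR α γ a ∧ (bk α β γ z a ≤ z ↔ β a ≤ z) := by
  have := bkL_le h1 h2 a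
  have := le_bkR h1 h2 a
  unfold bk
  split_ifs <;> omega

lemma bk_valid (hα : StrictMono α) (hγ : StrictMono γ) (h1 : Inter α β) (h2 : Inter β γ) (z : ℤ) :
    Inter α (bk α β γ z) ∧ Inter (bk α β γ z) γ ∧ StrictMono (bk α β γ z) :=
  inter_of_LR hα hγ (fun a => (bk_mem h1 h2 z a).1) (fun a => (bk_mem h1 h2 z a).2.1)

lemma bk_bk (h1 : Inter α β) (h2 : Inter β γ) (z : ℤ) :
    bk α (bk α β γ z) γ z = β := by
  funext a
  have h := (bk_mem h1 h2 z a).2.2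
  by_cases hz : β a ≤ z
  · have e : bk α β γ z a = bkL α γ a + min (bkR α γ a) z - β a := if_pos hz
    have e' : bk α (bk α β γ z) γ z a = bkL α γ a + min (bkR α γ a) z - bk α β γ z a :=
      if_pos (h.2 hz)
    rw [e', e]; ring
  · have e : bk α β γ z a = β a := if_neg hz
    have e' : bk α (bk α β γ z) γ z a = bk α β γ z a := if_neg (fun hh => hz (h.1 hh))
    rw [e', e]

lemma cnt_bk (h1 : Inter α β) (h2 : Inter β γ) (z : ℤ) {x : ℤ} (hx : z < x) :
    cnt (bk α β γ z) x = cnt β x := by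
  refine Finset.sum_congr rfl fun a _ => ?_
  have := bk_mem h1 h2 z a
  have : bk α β γ z a = bkL α γ a + min (bkR α γ a) z - β a ∨ bk α β γ z a = β a := by
    unfold bk; split_ifs <;> simp
  by_cases hz : β a ≤ z
  · rw [if_neg (by omega), if_neg (by omega)]
  · have e : bk α β γ z a = β a := if_neg hz
    rw [e]

lemma bk_seq_hyp (hβ : StrictMono β) (hγ : StrictMono γ) (h1 : Inter α β) {z : ℤ}
    (h : 1 ≤ cnt β (z + 1) - cnt α (z + 1) → 1 ≤ cnt γ z - cnt β z) :
    ∀ a, α a ≤ z → z < β a → ∃ a' : Fin k, a = a'.succ ∧ z ≤ γ a'.castSucc := by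
  intro a ha1 ha2
  have hlt : cnt α (z + 1) < cnt β (z + 1) := by
    refine Finset.sum_lt_sum (fun b _ => ?_) ⟨a, Finset.mem_univ _, ?_⟩
    · have := h1.1 b
      split_ifs <;> omega
    · rw [if_neg (by omega), if_pos (by omega)]; norm_num
  have h3 := h (by omega)
  by_contra hne
  have : cnt γ z ≤ cnt β z := by
    refine Finset.sum_le_sum fun b _ => ?_
    by_cases hb : a ≤ b
    · have := hβ.monotone hb
      rw [if_pos (show z ≤ β b by omega)]
      split_ifs <;> omega
    · have : γ b < z := by
        by_contra hb2
        apply hne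
        have ha0 : a ≠ 0 := by rintro rfl; exact hb (Fin.zero_le b)
        obtain ⟨a', rfl⟩ := Fin.exists_succ_eq.2 ha0
        refine ⟨a', rfl, ?_⟩
        have := hγ.monotone (Fin.le_castSucc_iff.2 (not_le.1 hb))
        omega
      rw [if_neg (by omega)]
      split_ifs <;> omega
  omega

lemma bk_sum (hβ : StrictMono β) (hγ : StrictMono γ) (h1 : Inter α β) (h2 : Inter β γ) {z : ℤ}
    (h : 1 ≤ cnt β (z + 1) - cnt α (z + 1) → 1 ≤ cnt γ z - cnt β z) :
    ∑ a, min (bk α β γ z a) z + ∑ a, min (β a) z =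
      ∑ a, min (α a) z + ∑ a, min (γ a) z - (cnt β (z + 1) - cnt α (z + 1)) := by
  have hs := bk_seq_hyp hβ hγ h1 h
  have e1 : ∑ a, min (bk α β γ z a) z + ∑ a, min (β a) z =
      ∑ a, min (bkL α γ a) z + ∑ a, min (bkR α γ a) z := by
    rw [← Finset.sum_add_distrib, ← Finset.sum_add_distrib]
    refine Finset.sum_congr rfl fun a _ => ?_
    have hL := bkL_le h1 h2 a
    have hR := le_bkR h1 h2 a
    by_cases hz : β a ≤ z
    · have e : bk α β γ z a = bkL α γ a + min (bkR α γ a) z - β a := if_pos hz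
      omega
    · have e : bk α β γ z a = β a := if_neg hz
      have : z ≤ bkL α γ a := by
        by_cases hα : α a ≤ z
        · obtain ⟨a', rfl, ha'⟩ := hs a hα (by omega)
          rw [bkL_succ]; omega
        · revert hα
          refine Fin.cases ?_ (fun a => ?_) a
          · rw [bkL_zero]; omega
          · rw [bkL_succ]; omega
      omega
  have e2 : cnt β (z + 1) - cnt α (z + 1) =
      ∑ a : Fin k, if α a.succ ≤ z ∧ z ≤ γ a.castSucc then 1 else 0 := by
    unfold cnt
    rw [← Finset.sum_sub_distrib, Fin.sum_univ_succ]
    have : ¬ (α 0 ≤ z ∧ z < β 0) := by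
      rintro ⟨q1, q2⟩
      obtain ⟨a', ha', -⟩ := hs 0 q1 q2
      exact (Fin.succ_ne_zero a') ha'.symm
    have h0 := h1.1 0
    have : ((if z + 1 ≤ β 0 then (1 : ℤ) else 0) - if z + 1 ≤ α 0 then 1 else 0) = 0 := by
      split_ifs <;> omega
    rw [this, zero_add]
    refine Finset.sum_congr rfl fun a _ => ?_
    have h3 := h2.2 a.castSucc a.succ Fin.castSucc_lt_succ
    have h4 := h1.1 a.succ
    have h5 : α a.succ ≤ z → z < β a.succ → z ≤ γ a.castSucc := by
      intro q1 q2
      obtain ⟨a', ha', q⟩ := hs _ q1 q2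
      rw [Fin.succ_inj.1 ha']; exact q
    split_ifs <;> omega
  rw [e1, e2, Fin.sum_univ_succ (fun a => min (bkL α γ a) z),
    Fin.sum_univ_castSucc (fun a => min (bkR α γ a) z), Fin.sum_univ_succ (fun a => min (α a) z),
    Fin.sum_univ_castSucc (fun a => min (γ a) z)]
  simp only [bkL_zero, bkL_succ, bkR_last, bkR_castSucc]
  have : ∑ i : Fin k, min (max (α i.succ) (γ i.castSucc + 1)) z
      + ∑ i : Fin k, min (min (γ i.castSucc) (α i.succ - 1)) z
      = ∑ i : Fin k, min (α i.succ) z + ∑ i : Fin k, min (γ i.castSucc) z -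
      ∑ a : Fin k, if α a.succ ≤ z ∧ z ≤ γ a.castSucc then 1 else 0 := by
    rw [← Finset.sum_add_distrib, ← Finset.sum_add_distrib, ← Finset.sum_sub_distrib]
    refine Finset.sum_congr rfl fun a _ => ?_
    split_ifs <;> omega
  linarith

lemma sum_min_add_pos {k : ℕ} (K : Fin k → ℤ) (z : ℤ) : ∑ a, K a = ∑ a, min (K a) z + pos K z := by
  unfold pos
  rw [← Finset.sum_add_distrib]
  exact Finset.sum_congr rfl fun a _ => by omega

/-- The defect of a row triple. -/
lemma bk_defect (hβ : StrictMono β) (hγ : StrictMono γ) (h1 : Inter α β) (h2 : Inter β γ) {z : ℤ}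
    (h : 1 ≤ cnt β (z + 1) - cnt α (z + 1) → 1 ≤ cnt γ z - cnt β z) :
    (2 * ∑ a, bk α β γ z a - ∑ a, α a - ∑ a, γ a) + (2 * ∑ a, β a - ∑ a, α a - ∑ a, γ a) =
      2 * ((2 * pos β z - pos α z - pos γ z) - (cnt β (z + 1) - cnt α (z + 1))) := by
  have := bk_sum hβ hγ h1 h2 h
  have e := pos_congr (bk α β γ z) β z (fun x hx => cnt_bk h1 h2 z hx) z le_rfl
  rw [sum_min_add_pos (bk α β γ z) z, sum_min_add_pos β z, sum_min_add_pos α z,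
    sum_min_add_pos γ z, e]
  linarith
end
end JT

namespace JT

section
variable {k : ℕ}

/-- valid pair of chains -/
def VT (T : Bool → ℕ → Fin (k + 1) → ℤ) : Prop :=
  ∀ c m, StrictMono (T c m) ∧ Inter (T c m) (T c (m + 1))

def cT (T : Bool → ℕ → Fin (k + 1) → ℤ) (m : ℕ) : Bool → ℤ → ℤ := fun c x => cnt (T c m) x

def pT (T : Bool → ℕ → Fin (k + 1) → ℤ) (m : ℕ) (y : ℤ) : ℤ := pos (T true m) y + pos (T false m) y

def AT (T : Bool → ℕ → Fin (k + 1) → ℤ) (i : ℕ) (y : ℤ) : ℤ :=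
  2 * pT T (i + 1) y - pT T i y - pT T (i + 2) y

/-- passing the check at `(y,i)` with colour `c` first -/
def PassT (T : Bool → ℕ → Fin (k + 1) → ℤ) (c : Bool) (y : ℤ) (i : ℕ) : Prop :=
  Pass (cT T i) (cT T (i + 1)) (cT T (i + 2)) (AT T i) y c

def DBT (T : Bool → ℕ → Fin (k + 1) → ℤ) (y : ℤ) (i : ℕ) : Prop :=
  DB (cT T i) (cT T (i + 1)) (cT T (i + 2)) (AT T i) y

lemma exists_bound (K : Fin (k + 1) → ℤ) : ∃ M : ℤ, ∀ a, K a ≤ M := by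
  refine ⟨∑ a, |K a|, fun a => ?_⟩
  have h1 := Finset.single_le_sum (f := fun a => |K a|) (fun i _ => abs_nonneg _)
    (Finset.mem_univ a)
  exact (le_abs_self (K a)).trans h1

lemma loc_of_valid {T : Bool → ℕ → Fin (k + 1) → ℤ} (h : VT T) (i : ℕ) :
    Loc (cT T i) (cT T (i + 1)) (cT T (i + 2)) (AT T i) where
  ab c x := cnt_le (h c i).2 x
  ab' c x := cnt_le' (h c i).2 x
  bg c x := cnt_le (h c (i + 1)).2 x
  bg' c x := cnt_le' (h c (i + 1)).2 x
  sa c x := cnt_anti _ (by omega)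
  sa' c x := cnt_le' (Inter.refl (h c i).1) x
  sb c x := cnt_anti _ (by omega)
  sb' c x := cnt_le' (Inter.refl (h c (i + 1)).1) x
  sg c x := cnt_anti _ (by omega)
  sg' c x := cnt_le' (Inter.refl (h c (i + 2)).1) x
  hA y := by
    have H : ∀ c m, pos (T c m) y = pos (T c m) (y + 1) + cT T m c (y + 1) := by
      intro c m
      have := pos_sub (T c m) (y + 1)
      rwa [add_sub_cancel_right] at this
    unfold AT pT
    rw [H, H, H, H, H, H]
    ring
  top := by
    choose M hM using fun c m => exists_bound (T c m)
    have hle : ∀ c m, M c m ≤ |M c m| := fun c m => le_abs_self _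
    have h0 : ∀ c m, 0 ≤ |M c m| := fun c m => abs_nonneg _
    refine ⟨1 + |M true i| + |M true (i + 1)| + |M true (i + 2)| + |M false i| + |M false (i + 1)|
      + |M false (i + 2)|, fun x hx => ?_⟩
    have key : ∀ c m, (m = i ∨ m = i + 1 ∨ m = i + 2) → ∀ a, T c m a < x := by
      intro c m hm a
      have := hM c m a
      have := hle true i
      have := hle true (i + 1)
      have := hle true (i + 2)
      have := hle false i
      have := hle false (i + 1)
      have := hle false (i + 2)
      have := h0 true i
      have := h0 true (i + 1)
      have := h0 true (i + 2)
      have := h0 false i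
      have := h0 false (i + 1)
      have := h0 false (i + 2)
      rcases hm with rfl | rfl | rfl <;> cases c <;> linarith
    constructor
    · unfold AT pT
      rw [pos_eq_zero _ fun a => (key true i (by simp) a).le,
        pos_eq_zero _ fun a => (key true (i + 1) (by simp) a).le,
        pos_eq_zero _ fun a => (key true (i + 2) (by simp) a).le,
        pos_eq_zero _ fun a => (key false i (by simp) a).le,
        pos_eq_zero _ fun a => (key false (i + 1) (by simp) a).le,
        pos_eq_zero _ fun a => (key false (i + 2) (by simp) a).le]
      simp
    · intro c
      exact ⟨cnt_eq_zero _ (key c _ (by simp)), cnt_eq_zero _ (key c _ (by simp)),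
        cnt_eq_zero _ (key c _ (by simp))⟩

/-- replace row `i+1` by truncated BK moves -/
def moveZ (T : Bool → ℕ → Fin (k + 1) → ℤ) (i : ℕ) (z : Bool → ℤ) : Bool → ℕ → Fin (k + 1) → ℤ :=
  fun c m => if m = i + 1 then bk (T c i) (T c (i + 1)) (T c (i + 2)) (z c) else T c m

lemma moveZ_ne (T : Bool → ℕ → Fin (k + 1) → ℤ) (i : ℕ) (z : Bool → ℤ) (c : Bool) {m : ℕ}
    (h : m ≠ i + 1) : moveZ T i z c m = T c m := if_neg h

lemma moveZ_eq (T : Bool → ℕ → Fin (k + 1) → ℤ) (i : ℕ) (z : Bool → ℤ) (c : Bool) :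
    moveZ T i z c (i + 1) = bk (T c i) (T c (i + 1)) (T c (i + 2)) (z c) := if_pos rfl

lemma moveZ_valid {T : Bool → ℕ → Fin (k + 1) → ℤ} (h : VT T) (i : ℕ) (z : Bool → ℤ) :
    VT (moveZ T i z) := by
  intro c m
  obtain ⟨b1, b2, b3⟩ := bk_valid (h c i).1 (h c (i + 2)).1 (h c i).2 (h c (i + 1)).2 (z c)
  by_cases h1 : m = i + 1
  · subst h1
    rw [moveZ_eq, moveZ_ne _ _ _ _ (by omega)]
    exact ⟨b3, b2⟩
  · rw [moveZ_ne _ _ _ _ h1]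
    refine ⟨(h c m).1, ?_⟩
    by_cases h2 : m = i
    · subst h2; rw [moveZ_eq]; exact b1
    · rw [moveZ_ne _ _ _ _ (by omega)]; exact (h c m).2

lemma moveZ_moveZ {T : Bool → ℕ → Fin (k + 1) → ℤ} (h : VT T) (i : ℕ) (z : Bool → ℤ) :
    moveZ (moveZ T i z) i z = T := by
  funext c m
  by_cases h1 : m = i + 1
  · subst h1
    rw [moveZ_eq, moveZ_eq, moveZ_ne _ _ _ _ (by omega), moveZ_ne _ _ _ _ (by omega)]
    exact bk_bk (h c i).2 (h c (i + 1)).2 (z c)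
  · rw [moveZ_ne _ _ _ _ h1, moveZ_ne _ _ _ _ h1]

lemma cT_moveZ {T : Bool → ℕ → Fin (k + 1) → ℤ} (h : VT T) (i : ℕ) (z : Bool → ℤ) (m : ℕ) (c : Bool)
    (x : ℤ) (hx : m ≠ i + 1 ∨ z c < x) : cT (moveZ T i z) m c x = cT T m c x := by
  unfold cT
  by_cases h1 : m = i + 1
  · subst h1
    rw [moveZ_eq]
    exact cnt_bk (h c i).2 (h c (i + 1)).2 (z c) (by tauto)
  · rw [moveZ_ne _ _ _ _ h1]

lemma pT_moveZ {T : Bool → ℕ → Fin (k + 1) → ℤ} (h : VT T) (i : ℕ) (z : Bool → ℤ) (m : ℕ)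
    (y : ℤ) (hy : ∀ c, z c ≤ y) : pT (moveZ T i z) m y = pT T m y := by
  unfold pT
  rw [pos_congr _ (T true m) (z true) (fun x hx => cT_moveZ h i z m true x (Or.inr hx)) y (hy _),
    pos_congr _ (T false m) (z false) (fun x hx => cT_moveZ h i z m false x (Or.inr hx)) y (hy _)]

lemma Pass_congr {a b g a' b' g' : Bool → ℤ → ℤ} {A A' : ℤ → ℤ} {y : ℤ} {c : Bool}
    (hA : A' y = A y) (ha : ∀ c, a' c y = a c y) (hb : ∀ c, b' c y = b c y)
    (hg : ∀ c, g' c y = g c y) (hg1 : ∀ c, g' c (y - 1) = g c (y - 1))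
    (ha1 : ∀ c, a' c (y + 1) = a c (y + 1)) (hb1 : ∀ c, b' c (y + 1) = b c (y + 1)) :
    Pass a' b' g' A' y c ↔ Pass a b g A y c := by
  unfold Pass DB CT N1
  simp only [hA, ha, hb, hg, hg1, ha1, hb1]

open Classical in
/-- truncation heights of the move -/
noncomputable def zOf (T : Bool → ℕ → Fin (k + 1) → ℤ) (i : ℕ) (y : ℤ) (b : Bool) : Bool → ℤ :=
  fun c => if DBT T y i ∧ c ≠ b then y else y - 1

lemma zOf_le (T : Bool → ℕ → Fin (k + 1) → ℤ) (i : ℕ) (y : ℤ) (b c : Bool) : zOf T i y b c ≤ y := by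
  unfold zOf; split_ifs <;> omega

lemma zOf_lt (T : Bool → ℕ → Fin (k + 1) → ℤ) (i : ℕ) (y : ℤ) (b c : Bool)
    (h : ¬ (DBT T y i ∧ c ≠ b)) : zOf T i y b c = y - 1 := if_neg h

lemma zOf_eq (T : Bool → ℕ → Fin (k + 1) → ℤ) (i : ℕ) (y : ℤ) (b c : Bool)
    (h : DBT T y i ∧ c ≠ b) : zOf T i y b c = y := if_pos h

lemma AT_moveZ {T : Bool → ℕ → Fin (k + 1) → ℤ} (h : VT T) (i : ℕ) (z : Bool → ℤ) (j : ℕ)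
    (y : ℤ) (hy : ∀ c, z c ≤ y) : AT (moveZ T i z) j y = AT T j y := by
  unfold AT
  rw [pT_moveZ h _ _ _ _ hy, pT_moveZ h _ _ _ _ hy, pT_moveZ h _ _ _ _ hy]

lemma DBT_move {T : Bool → ℕ → Fin (k + 1) → ℤ} (h : VT T) (i : ℕ) (y : ℤ) (b : Bool) :
    DBT (moveZ T i (zOf T i y b)) y i ↔ DBT T y i := by
  have hz := zOf_le T i y b
  have hA := AT_moveZ h i _ i y hz
  have e0 : ∀ c x, cT (moveZ T i (zOf T i y b)) i c x = cT T i c x :=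
    fun c x => cT_moveZ h _ _ _ _ _ (Or.inl (by omega))
  have e2 : ∀ c x, cT (moveZ T i (zOf T i y b)) (i + 2) c x = cT T (i + 2) c x :=
    fun c x => cT_moveZ h _ _ _ _ _ (Or.inl (by omega))
  have e1 : ∀ c, cT (moveZ T i (zOf T i y b)) (i + 1) c (y + 1) = cT T (i + 1) c (y + 1) :=
    fun c => cT_moveZ h _ _ _ _ _ (Or.inr (by have := hz c; omega))
  unfold DBT DB N1
  simp only [hA, e0, e2, e1]
  have : ∀ p q r s t u : ℤ, p - q + (r - s) + (t - p + (u - r)) = t + u - q - s := by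
    intros; ring
  rw [this, this]

lemma zOf_move {T : Bool → ℕ → Fin (k + 1) → ℤ} (h : VT T) (i : ℕ) (y : ℤ) (b : Bool) :
    zOf (moveZ T i (zOf T i y b)) i y b = zOf T i y b := by
  funext c
  have := DBT_move h i y b
  by_cases hc : DBT T y i ∧ c ≠ b
  · rw [zOf_eq T i y b c hc, zOf_eq _ _ _ _ _ ⟨this.2 hc.1, hc.2⟩]
  · rw [zOf_lt T i y b c hc, zOf_lt _ _ _ _ _ (fun hh => hc ⟨this.1 hh.1, hh.2⟩)]

/-- the check fails after the move -/
lemma fail_move {T : Bool → ℕ → Fin (k + 1) → ℤ} (h : VT T) (i : ℕ) (y : ℤ) (b : Bool)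
    (hf : ¬ PassT T b y i) : ¬ PassT (moveZ T i (zOf T i y b)) b y i := by
  have hD := DBT_move h i y b
  have hz := zOf_le T i y b
  by_cases hd : DBT T y i
  · intro hp
    apply hf
    refine ⟨fun _ => ?_, fun hn => absurd hd hn⟩
    have := hp.1 (hD.2 hd)
    rwa [cT_moveZ h _ _ _ _ _ (Or.inl (by omega)), cT_moveZ h _ _ _ _ _ (Or.inr ?_)] at this
    rw [zOf_lt _ _ _ _ _ (by simp)]; omega
  · have hz' : ∀ c, zOf T i y b c = y - 1 := fun c => zOf_lt _ _ _ _ _ (fun hh => hd hh.1)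
    intro hp
    apply hf
    refine (Pass_congr ?_ ?_ ?_ ?_ ?_ ?_ ?_).1 hp
    · exact AT_moveZ h i _ i y hz
    all_goals intro c; refine cT_moveZ h _ _ _ _ _ ?_; have := hz' c; omega

/-- later checks still pass after the move -/
lemma pass_move {T : Bool → ℕ → Fin (k + 1) → ℤ} (h : VT T) (N i : ℕ) (y : ℤ)
    (col : ℤ → ℕ → Bool)
    (hp : ∀ y' j, j + 1 < N → (y < y' ∨ y' = y ∧ i < j) → PassT T (col y' j) y' j)
    (hi : i + 1 < N)
    (hf : ¬ PassT T (col y i) y i) :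
    ∀ y' j, j + 1 < N → (y < y' ∨ y' = y ∧ i < j) →
      PassT (moveZ T i (zOf T i y (col y i))) (col y' j) y' j := by
  intro y' j hj hy
  have hpj := hp y' j hj hy
  set b := col y i with hb
  have hz := zOf_le T i y b
  have hz' : ∀ c, zOf T i y b c ≤ y' := fun c => (hz c).trans (by omega)
  have hV' := moveZ_valid h i (zOf T i y b)
  by_cases hd : DBT T y i
  swap
  · have hz' : ∀ c, zOf T i y b c = y - 1 := fun c => zOf_lt _ _ _ _ _ (fun hh => hd hh.1)
    refine (Pass_congr ?_ ?_ ?_ ?_ ?_ ?_ ?_).2 hpj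
    · exact AT_moveZ h i _ j y' (by intro c; have := hz' c; omega)
    all_goals intro c; refine cT_moveZ h _ _ _ _ _ ?_; have := hz' c; omega
  by_cases s1 : y' = y + 1 ∧ j + 1 = i
  · obtain ⟨rfl, rfl⟩ := s1
    refine pass_of_le (loc_of_valid hV' j) ?_ _
    rw [AT_moveZ h _ _ _ _ hz']
    have hA : 0 ≤ AT T j (y + 1) :=
      A_nonneg (loc_of_valid h j) (hp (y + 1 + 1) j hj (by omega))
    have h0 := hd.2.2.2
    have : N1 (cT (moveZ T (j + 1) (zOf T (j + 1) y b)) (j + 1))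
        (cT (moveZ T (j + 1) (zOf T (j + 1) y b)) (j + 2)) (y + 1) =
        N1 (cT T (j + 1)) (cT T (j + 2)) (y + 1) := by
      unfold N1
      have e : ∀ m c, cT (moveZ T (j + 1) (zOf T (j + 1) y b)) m c (y + 1) = cT T m c (y + 1) :=
        fun m c => cT_moveZ h _ _ _ _ _ (Or.inr (by have := hz c; omega))
      simp only [e]
    rw [this]
    have h0' : N1 (cT T (j + 1)) (cT T (j + 2)) (y + 1) = 0 := h0
    omega
  by_cases s2 : y' = y ∧ j = i + 1
  · obtain ⟨rfl, rfl⟩ := s2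
    refine pass_of_le (loc_of_valid hV' _) ?_ _
    rw [AT_moveZ h _ _ _ _ hz']
    have e : N1 (cT (moveZ T i (zOf T i y' b)) (i + 1 + 1))
        (cT (moveZ T i (zOf T i y' b)) (i + 1 + 2)) y' =
        N1 (cT T (i + 2)) (cT T (i + 3)) y' := by
      unfold N1
      have e : ∀ m c, m ≠ i + 1 → cT (moveZ T i (zOf T i y' b)) m c y' = cT T m c y' :=
        fun m c hm => cT_moveZ h _ _ _ _ _ (Or.inl hm)
      rw [e _ _ (by omega), e _ _ (by omega), e _ _ (by omega), e _ _ (by omega)]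
    rw [e]
    have H := loc_of_valid h i
    have H' := loc_of_valid h (i + 1)
    have e3 : i + 1 + 2 = i + 3 := rfl
    have e2 : i + 1 + 1 = i + 2 := rfl
    rw [e2, e3] at H'
    have hL := fun X => Lstar H' (y := y') (X := X)
      (fun y'' hy'' => ⟨_, hp y'' (i + 1) hj (Or.inl hy'')⟩)
    have hAn : 0 ≤ AT T (i + 1) y' :=
      A_nonneg H' (hp (y' + 1) (i + 1) hj (by omega))
    by_contra hcon
    have hN2 : AT T (i + 1) y' = 0 ∧ N1 (cT T (i + 1)) (cT T (i + 2)) y' = 1 ∧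
        N1 (cT T (i + 2)) (cT T (i + 3)) y' = 1 := by
      by_cases hdj : DB (cT T (i + 1)) (cT T (i + 2)) (cT T (i + 3)) (AT T (i + 1)) y'
      · have q1 := hpj.1 hdj
        rw [e3, e2] at q1
        have q2 := hdj.1
        have q3 := hdj.2.1
        have := H'.bg true y'
        have := H'.bg false y'
        have := H'.bg' true y'
        have := H'.bg' false y'
        have := H'.sb true y'
        have := H'.sb false y'
        unfold N1 at *
        generalize col y' (i + 1) = cc at q1
        cases cc <;> omega
      · rcases hpj.2 hdj with q | q
        · exact absurd q hcon
        · exact ⟨q.1, q.2.1, q.2.2.1⟩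
    obtain ⟨hA0, hn1, hn2⟩ := hN2
    have hf' : cT T (i + 2) b y' ≠ cT T (i + 1) b y' := by
      intro hh
      exact hf ⟨fun _ => hh, fun hn => absurd hd hn⟩
    obtain ⟨d1, d2, d3, d4⟩ := hd
    -- colour analysis
    have F1 : ∀ X, cT T (i + 3) X y' = cT T (i + 2) X y' + 1 →
        cT T (i + 2) X (y' + 1) = cT T (i + 1) X (y' + 1) + 1 → False := by
      intro X q1 q2
      have := hL X q1 q2
      omega
    have hX : ∃ X, cT T (i + 3) X y' = cT T (i + 2) X y' + 1 := by
      by_contra hno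
      push Not at hno
      have := hno true
      have := hno false
      have := H'.bg true y'
      have := H'.bg false y'
      unfold N1 at hn2
      omega
    obtain ⟨X, hX⟩ := hX
    refine F1 X hX ?_
    have a1 := H.bg true y'
    have a2 := H.bg false y'
    have a3 := H.ab true y'
    have a4 := H.ab false y'
    have a5 := H.ab true (y' + 1)
    have a6 := H.ab false (y' + 1)
    have a7 := H'.bg' X y'
    have a8 := H'.sb X y'
    have a9 := H.sb X y'
    have a10 := H.sb' X y'
    have a11 := H.bg X (y' + 1)
    have a12 := H.bg' X (y' + 1)
    have a13 := H.sb X (y' + 1)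
    have a14 := H.ab' X y'
    have a15 := H.sa X y'
    have b1 := H.bg' b y'
    have b2 := H.ab' b y'
    have b3 := H.sa b y'
    have b4 := H.sb b y'
    unfold N1 at *
    clear_value b
    cases X <;> cases b <;> omega
  · refine (Pass_congr ?_ ?_ ?_ ?_ ?_ ?_ ?_).2 hpj
    · exact AT_moveZ h i _ j y' hz'
    all_goals intro c; refine cT_moveZ h _ _ _ _ _ ?_; have := hz c; omega

/-- total of row `m` -/
def tot (T : Bool → ℕ → Fin (k + 1) → ℤ) (m : ℕ) : ℤ := ∑ a, T true m a + ∑ a, T false m a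

lemma tot_move {T : Bool → ℕ → Fin (k + 1) → ℤ} (h : VT T) (i : ℕ) (y : ℤ) (b : Bool)
    (hp : ∀ y', y < y' → ∃ c, PassT T c y' i)
    (hf : ¬ PassT T b y i) :
    (2 * tot (moveZ T i (zOf T i y b)) (i + 1) - tot T i - tot T (i + 2)) +
      (2 * tot T (i + 1) - tot T i - tot T (i + 2)) = -2 := by
  have H := loc_of_valid h i
  have key : ∀ c, (1 ≤ cT T (i + 1) c (zOf T i y b c + 1) - cT T i c (zOf T i y b c + 1) →
      1 ≤ cT T (i + 2) c (zOf T i y b c) - cT T (i + 1) c (zOf T i y b c)) → _ :=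
    fun c hc => bk_defect (h c (i + 1)).1 (h c (i + 2)).1 (h c i).2 (h c (i + 1)).2
      (z := zOf T i y b c) hc
  have main : (∀ c, (1 ≤ cT T (i + 1) c (zOf T i y b c + 1) - cT T i c (zOf T i y b c + 1) →
      1 ≤ cT T (i + 2) c (zOf T i y b c) - cT T (i + 1) c (zOf T i y b c))) ∧
      (2 * pos (T true (i + 1)) (zOf T i y b true) - pos (T true i) (zOf T i y b true)
        - pos (T true (i + 2)) (zOf T i y b true))
        - (cT T (i + 1) true (zOf T i y b true + 1) - cT T i true (zOf T i y b true + 1))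
      + ((2 * pos (T false (i + 1)) (zOf T i y b false) - pos (T false i) (zOf T i y b false)
        - pos (T false (i + 2)) (zOf T i y b false))
        - (cT T (i + 1) false (zOf T i y b false + 1) - cT T i false (zOf T i y b false + 1)))
      = -1 := by
    have hps : ∀ c m, pos (T c m) (y - 1) = pos (T c m) y + cT T m c y := fun c m => pos_sub _ _
    by_cases hd : DBT T y i
    · have hf' : cT T (i + 2) b y ≠ cT T (i + 1) b y := by
        intro hh
        exact hf ⟨fun _ => hh, fun hn => absurd hd hn⟩
      have z1 : zOf T i y b b = y - 1 := zOf_lt _ _ _ _ _ (by simp)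
      have z2 : zOf T i y b (!b) = y := zOf_eq _ _ _ _ _ ⟨hd, by simp⟩
      obtain ⟨d1, d2, d3, d4⟩ := hd
      unfold AT pT at d1
      have a1 := H.bg true y
      have a2 := H.bg false y
      have a3 := H.ab true y
      have a4 := H.ab false y
      have a5 := H.ab true (y + 1)
      have a6 := H.ab false (y + 1)
      have a7 := H.bg' true y
      have a8 := H.bg' false y
      have a9 := H.sb true y
      have a10 := H.sb false y
      have a14 := H.ab' true y
      have a15 := H.sa true y
      have a16 := H.ab' false y
      have a17 := H.sa false y
      unfold N1 at *
      have e : y - 1 + 1 = y := by ring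
      cases b
      · simp only [Bool.not_false] at z2
        rw [Bool.forall_bool]
        rw [z1, z2, hps, hps, hps, e]
        refine ⟨⟨by omega, by omega⟩, by omega⟩
      · simp only [Bool.not_true] at z2
        rw [Bool.forall_bool]
        rw [z1, z2, hps, hps, hps, e]
        refine ⟨⟨by omega, by omega⟩, by omega⟩
    · have hz' : ∀ c, zOf T i y b c = y - 1 := fun c => zOf_lt _ _ _ _ _ (fun hh => hd hh.1)
      have hf1 : ¬ (N1 (cT T (i + 1)) (cT T (i + 2)) y ≤ AT T i y ∨
          CT (cT T i) (cT T (i + 1)) (cT T (i + 2)) (AT T i) y) :=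
        fun hh => hf ⟨fun hd' => absurd hd' hd, fun _ => hh⟩
      push Not at hf1
      obtain ⟨r1, r2⟩ := fail_nonDB H hp hd (not_le.2 hf1.1) hf1.2
      have e : y - 1 + 1 = y := by ring
      unfold AT pT N1 at r1
      simp only [hz', e, hps]
      refine ⟨r2, by omega⟩
  obtain ⟨m1, m2⟩ := main
  have k1 := key true (m1 true)
  have k2 := key false (m1 false)
  unfold tot
  rw [moveZ_eq, moveZ_eq]
  unfold cT at m2
  linarith
end
end JT

namespace JT

section
variable {k : ℕ}

def Yam (N : ℕ) (lo hi : ℤ) (col : ℤ → ℕ → Bool) (T : Bool → ℕ → Fin (k + 1) → ℤ) : Prop :=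
  ∀ y i, lo < y → y ≤ hi → i + 1 < N → PassT T (col y i) y i

def IsFirst (N : ℕ) (lo hi : ℤ) (col : ℤ → ℕ → Bool) (T : Bool → ℕ → Fin (k + 1) → ℤ)
    (p : ℤ × ℕ) : Prop :=
  lo < p.1 ∧ p.1 ≤ hi ∧ p.2 + 1 < N ∧ ¬ PassT T (col p.1 p.2) p.1 p.2 ∧
    ∀ y' j, j + 1 < N → (p.1 < y' ∨ y' = p.1 ∧ p.2 < j) → PassT T (col y' j) y' j

lemma pass_top {T : Bool → ℕ → Fin (k + 1) → ℤ} (h : VT T) {hi : ℤ}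
    (hb : ∀ c m a, T c m a ≤ hi) {y : ℤ} (hy : hi < y) (c : Bool) (i : ℕ) : PassT T c y i := by
  refine pass_of_le (loc_of_valid h i) ?_ c
  have h1 : ∀ m c, cT T m c y = 0 := fun m c => cnt_eq_zero _ fun a => (hb c m a).trans_lt hy
  have h2 : ∀ c m, pos (T c m) y = 0 := fun c m => pos_eq_zero _ fun a => (hb c m a).trans hy.le
  unfold AT pT N1
  simp only [h1, h2]
  simp

lemma exists_first {N : ℕ} {lo hi : ℤ} {col : ℤ → ℕ → Bool} {T : Bool → ℕ → Fin (k + 1) → ℤ}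
    (h : VT T) (hb : ∀ c m a, T c m a ≤ hi) (hY : ¬ Yam N lo hi col T) :
    ∃ p, IsFirst N lo hi col T p := by
  classical
  unfold Yam at hY
  push Not at hY
  obtain ⟨y, i, h1, h2, h3, h4⟩ := hY
  set F := (Finset.Ioc lo hi ×ˢ Finset.range (N - 1)).filter
    (fun p : ℤ × ℕ => ¬ PassT T (col p.1 p.2) p.1 p.2) with hF
  have hmem : ∀ p : ℤ × ℕ, p ∈ F ↔ (lo < p.1 ∧ p.1 ≤ hi) ∧ p.2 + 1 < N ∧
      ¬ PassT T (col p.1 p.2) p.1 p.2 := by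
    intro p
    rw [hF, Finset.mem_filter, Finset.mem_product, Finset.mem_Ioc, Finset.mem_range, and_assoc]
    have : p.2 < N - 1 ↔ p.2 + 1 < N := by omega
    rw [this]
  obtain ⟨p, hp, hmax⟩ := Finset.exists_max_image F (fun p => toLex p)
    ⟨(y, i), (hmem _).2 ⟨⟨h1, h2⟩, h3, h4⟩⟩
  obtain ⟨⟨a1, a2⟩, a3, a4⟩ := (hmem p).1 hp
  refine ⟨p, a1, a2, a3, a4, fun y' j hj hlt => ?_⟩
  by_contra hn
  have hy' : y' ≤ hi := by
    by_contra hy'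
    exact hn (pass_top h hb (not_le.1 hy') _ _)
  have := hmax (y', j) ((hmem _).2 ⟨⟨by simp only; omega, hy'⟩, hj, hn⟩)
  rw [Prod.Lex.toLex_le_toLex] at this
  simp only at this
  omega

lemma first_unique {N : ℕ} {lo hi : ℤ} {col : ℤ → ℕ → Bool} {T : Bool → ℕ → Fin (k + 1) → ℤ}
    {p q : ℤ × ℕ} (hp : IsFirst N lo hi col T p) (hq : IsFirst N lo hi col T q) : p = q := by
  obtain ⟨p1, p2, p3, p4, p5⟩ := hp
  obtain ⟨q1, q2, q3, q4, q5⟩ := hq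
  have h1 : ¬ (p.1 < q.1 ∨ q.1 = p.1 ∧ p.2 < q.2) := fun h => q4 (p5 _ _ q3 h)
  have h2 : ¬ (q.1 < p.1 ∨ p.1 = q.1 ∧ q.2 < p.2) := fun h => p4 (q5 _ _ p3 h)
  ext <;> omega

open Classical in
noncomputable def inv (N : ℕ) (lo hi : ℤ) (col : ℤ → ℕ → Bool) (T : Bool → ℕ → Fin (k + 1) → ℤ) :
    Bool → ℕ → Fin (k + 1) → ℤ :=
  if h : ∃ p, IsFirst N lo hi col T p then
    moveZ T h.choose.2 (zOf T h.choose.2 h.choose.1 (col h.choose.1 h.choose.2)) else T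

lemma inv_eq {N : ℕ} {lo hi : ℤ} {col : ℤ → ℕ → Bool} {T : Bool → ℕ → Fin (k + 1) → ℤ}
    {p : ℤ × ℕ} (hp : IsFirst N lo hi col T p) :
    inv N lo hi col T = moveZ T p.2 (zOf T p.2 p.1 (col p.1 p.2)) := by
  have h : ∃ p, IsFirst N lo hi col T p := ⟨p, hp⟩
  have := first_unique h.choose_spec hp
  unfold inv
  rw [dif_pos h, this]

lemma first_inv {N : ℕ} {lo hi : ℤ} {col : ℤ → ℕ → Bool} {T : Bool → ℕ → Fin (k + 1) → ℤ}
    (h : VT T) {p : ℤ × ℕ} (hp : IsFirst N lo hi col T p) :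
    IsFirst N lo hi col (moveZ T p.2 (zOf T p.2 p.1 (col p.1 p.2))) p :=
  ⟨hp.1, hp.2.1, hp.2.2.1, fail_move h _ _ _ hp.2.2.2.1,
    pass_move h N p.2 p.1 col hp.2.2.2.2 hp.2.2.1 hp.2.2.2.1⟩

lemma tot_moveZ_ne (T : Bool → ℕ → Fin (k + 1) → ℤ) (i : ℕ) (z : Bool → ℤ) {m : ℕ}
    (h : m ≠ i + 1) : tot (moveZ T i z) m = tot T m := by
  unfold tot
  rw [moveZ_ne _ _ _ _ h, moveZ_ne _ _ _ _ h]

open Classical in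
lemma sum_yam {M : Type*} [AddCommGroup M] [IsAddTorsionFree M] (N : ℕ) (lo hi : ℤ)
    (col : ℤ → ℕ → Bool) (S : Finset (Bool → ℕ → Fin (k + 1) → ℤ))
    (hS : ∀ T ∈ S, VT T) (hb : ∀ T ∈ S, ∀ c m a, T c m a ≤ hi)
    (hm : ∀ T ∈ S, ∀ i, i + 1 < N → ∀ z, moveZ T i z ∈ S)
    (Φ : (Bool → ℕ → Fin (k + 1) → ℤ) → M)
    (hΦ : ∀ T ∈ S, ∀ T' ∈ S, ∀ i, i + 1 < N → (∀ m, m ≠ i + 1 → tot T' m = tot T m) →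
      (2 * tot T' (i + 1) - tot T i - tot T (i + 2)) +
      (2 * tot T (i + 1) - tot T i - tot T (i + 2)) = -2 → Φ T' = - Φ T) :
    ∑ T ∈ S, Φ T = ∑ T ∈ S.filter (Yam N lo hi col), Φ T := by
  rw [← Finset.sum_filter_add_sum_filter_not S (Yam N lo hi col)]
  rw [add_eq_left]
  have hfirst : ∀ T ∈ S.filter (fun T => ¬ Yam N lo hi col T), ∃ p, IsFirst N lo hi col T p := by
    intro T hT
    rw [Finset.mem_filter] at hT
    exact exists_first (hS T hT.1) (hb T hT.1) hT.2
  have hneg : ∀ T ∈ S.filter (fun T => ¬ Yam N lo hi col T),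
      Φ (inv N lo hi col T) = - Φ T := by
    intro T hT
    obtain ⟨p, hp⟩ := hfirst T hT
    rw [Finset.mem_filter] at hT
    rw [inv_eq hp]
    refine hΦ T hT.1 _ (hm T hT.1 _ hp.2.2.1 _) p.2 hp.2.2.1
      (fun m hm => tot_moveZ_ne _ _ _ hm) ?_
    refine tot_move (hS T hT.1) p.2 p.1 _ (fun y' hy' => ⟨_, hp.2.2.2.2 y' p.2 hp.2.2.1 (Or.inl hy')⟩)
      hp.2.2.2.1
  refine Finset.sum_involution (fun T _ => inv N lo hi col T) ?_ ?_ ?_ ?_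
  · intro T hT
    rw [hneg T hT]; simp
  · intro T hT h0 heq
    have := hneg T hT
    rw [heq] at this
    exact h0 (self_eq_neg.1 this)
  · intro T hT
    obtain ⟨p, hp⟩ := hfirst T hT
    rw [Finset.mem_filter] at hT ⊢
    rw [inv_eq hp]
    refine ⟨hm T hT.1 _ hp.2.2.1 _, fun hY => ?_⟩
    have := first_inv (hS T hT.1) hp
    exact this.2.2.2.1 (hY _ _ this.1 this.2.1 this.2.2.1)
  · intro T hT
    obtain ⟨p, hp⟩ := hfirst T hT
    rw [Finset.mem_filter] at hT
    have hp' := first_inv (hS T hT.1) hp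
    rw [inv_eq hp, inv_eq hp', zOf_move (hS T hT.1), moveZ_moveZ (hS T hT.1)]

/-- Yamanouchi pairs have antitone weight. -/
lemma yam_anti {N : ℕ} {lo hi : ℤ} {col : ℤ → ℕ → Bool} {T : Bool → ℕ → Fin (k + 1) → ℤ}
    (h : VT T) (hlo : ∀ c m a, lo ≤ T c m a) (hhi : lo < hi) (hY : Yam N lo hi col T) {i : ℕ}
    (hi' : i + 1 < N) : 0 ≤ 2 * tot T (i + 1) - tot T i - tot T (i + 2) := by
  have := A_nonneg (loc_of_valid h i) (hY (lo + 1) i (by omega) (by omega) hi')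
  unfold AT pT at this
  rw [pos_eq_sum _ (hlo _ _), pos_eq_sum _ (hlo _ _), pos_eq_sum _ (hlo _ _),
    pos_eq_sum _ (hlo _ _), pos_eq_sum _ (hlo _ _), pos_eq_sum _ (hlo _ _)] at this
  unfold tot
  linarith

/-! counting colourings -/

open Classical in
noncomputable def pv (T : Bool → ℕ → Fin (k + 1) → ℤ) (c : Bool) (p : ℤ × ℕ) : ℕ :=
  if PassT T c p.1 p.2 then 1 else 0

noncomputable def GG (C : Finset (ℤ × ℕ)) (T : Bool → ℕ → Fin (k + 1) → ℤ) : ℕ :=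
  ∏ p ∈ C, (pv T true p + pv T false p)

noncomputable def checks (N : ℕ) (lo hi : ℤ) : Finset (ℤ × ℕ) := Finset.Ioc lo hi ×ˢ Finset.range (N - 1)

open Classical in
lemma GG_eq (N : ℕ) (lo hi : ℤ) (T : Bool → ℕ → Fin (k + 1) → ℤ) :
    GG (checks N lo hi) T = ∑ o ∈ (checks N lo hi).powerset,
      if Yam N lo hi (fun y i => decide ((y, i) ∈ o)) T then 1 else 0 := by
  unfold GG
  rw [Finset.prod_add]
  refine Finset.sum_congr rfl fun o ho => ?_
  rw [Finset.mem_powerset] at ho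
  have e1 : ∏ p ∈ o, pv T true p = ∏ p ∈ o, pv T (decide (p ∈ o)) p :=
    Finset.prod_congr rfl fun p hp => by simp [hp]
  have e2 : ∏ p ∈ checks N lo hi \ o, pv T false p =
      ∏ p ∈ checks N lo hi \ o, pv T (decide (p ∈ o)) p :=
    Finset.prod_congr rfl fun p hp => by
      rw [Finset.mem_sdiff] at hp
      simp [hp.2]
  rw [e1, e2, mul_comm, Finset.prod_sdiff ho]
  unfold pv
  rw [Finset.prod_boole]
  congr 1
  unfold Yam
  apply propext
  constructor
  · intro h y i h1 h2 h3
    exact h (y, i) (Finset.mem_product.2 ⟨Finset.mem_Ioc.2 ⟨h1, h2⟩, Finset.mem_range.2 (by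
      simp only; omega)⟩)
  · rintro h ⟨y, i⟩ hp
    obtain ⟨h1, h2⟩ := Finset.mem_product.1 hp
    rw [Finset.mem_Ioc] at h1
    rw [Finset.mem_range] at h2
    simp only at h1 h2
    exact h y i h1.1 h1.2 (by omega)

lemma GG_anti {N : ℕ} {lo hi : ℤ} {T : Bool → ℕ → Fin (k + 1) → ℤ}
    (h : VT T) (hlo : ∀ c m a, lo ≤ T c m a) (hhi : lo < hi) (hG : GG (checks N lo hi) T ≠ 0) {i : ℕ}
    (hi' : i + 1 < N) : 0 ≤ 2 * tot T (i + 1) - tot T i - tot T (i + 2) := by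
  classical
  rw [GG_eq] at hG
  obtain ⟨o, -, ho⟩ := Finset.exists_ne_zero_of_sum_ne_zero hG
  have : Yam N lo hi (fun y i => decide ((y, i) ∈ o)) T := by
    by_contra hn
    rw [if_neg hn] at ho
    exact ho rfl
  exact yam_anti h hlo hhi this hi'

open Classical in
lemma sum_GG {M : Type*} [AddCommGroup M] [IsAddTorsionFree M] (N : ℕ) (lo hi : ℤ)
    (S : Finset (Bool → ℕ → Fin (k + 1) → ℤ))
    (hS : ∀ T ∈ S, VT T) (hb : ∀ T ∈ S, ∀ c m a, T c m a ≤ hi)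
    (hm : ∀ T ∈ S, ∀ i, i + 1 < N → ∀ z, moveZ T i z ∈ S)
    (Φ : (Bool → ℕ → Fin (k + 1) → ℤ) → M)
    (hΦ : ∀ T ∈ S, ∀ T' ∈ S, ∀ i, i + 1 < N → (∀ m, m ≠ i + 1 → tot T' m = tot T m) →
      (2 * tot T' (i + 1) - tot T i - tot T (i + 2)) +
      (2 * tot T (i + 1) - tot T i - tot T (i + 2)) = -2 → Φ T' = - Φ T) :
    2 ^ (checks N lo hi).card • ∑ T ∈ S, Φ T = ∑ T ∈ S, GG (checks N lo hi) T • Φ T := by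
  simp only [GG_eq]
  rw [← Finset.card_powerset]
  rw [← Finset.sum_const]
  simp only [Finset.sum_smul]
  rw [Finset.sum_comm (s := S)]
  refine Finset.sum_congr rfl fun o _ => ?_
  rw [sum_yam N lo hi (fun y i => decide ((y, i) ∈ o)) S hS hb hm Φ hΦ, Finset.sum_filter]
  refine Finset.sum_congr rfl fun T _ => ?_
  split_ifs <;> simp

/-- same counting sums -/
def SameS (T T' : Bool → ℕ → Fin (k + 1) → ℤ) : Prop :=
  ∀ m x, cT T' m true x + cT T' m false x = cT T m true x + cT T m false x

lemma pT_sameS {T T' : Bool → ℕ → Fin (k + 1) → ℤ} (hs : SameS T T') {hi : ℤ}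
    (hb : ∀ c m a, T c m a ≤ hi) (hb' : ∀ c m a, T' c m a ≤ hi) (m : ℕ) (y : ℤ) :
    pT T' m y = pT T m y := by
  have key : ∀ n : ℕ, ∀ y, hi ≤ y + n → pT T' m y = pT T m y := by
    intro n
    induction n with
    | zero =>
      intro y hy
      unfold pT
      push_cast at hy
      rw [pos_eq_zero _ (fun a => (hb _ _ a).trans (by omega)),
        pos_eq_zero _ (fun a => (hb _ _ a).trans (by omega)),
        pos_eq_zero _ (fun a => (hb' _ _ a).trans (by omega)),
        pos_eq_zero _ (fun a => (hb' _ _ a).trans (by omega))]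
    | succ n ih =>
      intro y hy
      have hps : ∀ K : Fin (k + 1) → ℤ, pos K y = pos K (y + 1) + cnt K (y + 1) := by
        intro K
        have := pos_sub K (y + 1)
        rwa [add_sub_cancel_right] at this
      have h1 := ih (y + 1) (by push_cast at hy; omega)
      have h2 := hs m (y + 1)
      unfold pT at *
      unfold cT at h2
      rw [hps, hps, hps, hps]
      linarith
  exact key (hi - y).toNat y (by omega)

lemma tot_sameS {T T' : Bool → ℕ → Fin (k + 1) → ℤ} (hs : SameS T T') {lo hi : ℤ}
    (hb : ∀ c m a, T c m a ≤ hi) (hb' : ∀ c m a, T' c m a ≤ hi)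
    (hl : ∀ c m a, lo ≤ T c m a) (hl' : ∀ c m a, lo ≤ T' c m a) (m : ℕ) :
    tot T' m = tot T m := by
  have := pT_sameS hs hb hb' m lo
  unfold pT at this
  rw [pos_eq_sum _ (hl _ _), pos_eq_sum _ (hl _ _), pos_eq_sum _ (hl' _ _),
    pos_eq_sum _ (hl' _ _)] at this
  unfold tot
  linarith

lemma GG_sameS {T T' : Bool → ℕ → Fin (k + 1) → ℤ} (hs : SameS T T') (h : VT T) (h' : VT T') {hi : ℤ}
    (hb : ∀ c m a, T c m a ≤ hi) (hb' : ∀ c m a, T' c m a ≤ hi) (C : Finset (ℤ × ℕ)) :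
    GG C T' = GG C T := by
  classical
  refine Finset.prod_congr rfl fun p _ => ?_
  obtain ⟨y, i⟩ := p
  have hA : AT T' i = AT T i := by
    funext y
    unfold AT
    rw [pT_sameS hs hb hb', pT_sameS hs hb hb', pT_sameS hs hb hb']
  have hN : ∀ m m' y, N1 (cT T' m) (cT T' m') y = N1 (cT T m) (cT T m') y := by
    intro m m' y
    have h1 := hs m y
    have h2 := hs m' y
    unfold N1
    linarith
  have hDB : DBT T' y i ↔ DBT T y i := by
    unfold DBT DB
    rw [hA, hN, hN, hN, hs, hs]
  have hCT : CT (cT T' i) (cT T' (i + 1)) (cT T' (i + 2)) (AT T' i) y ↔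
      CT (cT T i) (cT T (i + 1)) (cT T (i + 2)) (AT T i) y := by
    unfold CT
    rw [hA, hN, hN, hs, hs]
  unfold pv
  by_cases hd : DBT T y i
  · have e : ∀ T : Bool → ℕ → Fin (k + 1) → ℤ, DBT T y i → ∀ c, PassT T c y i ↔
        cT T (i + 2) c y = cT T (i + 1) c y :=
      fun T hd c => ⟨fun hp => hp.1 hd, fun he => ⟨fun _ => he, fun hn => absurd hd hn⟩⟩
    simp only [e T hd, e T' (hDB.2 hd)]
    have H := loc_of_valid h i
    have H' := loc_of_valid h' i
    have a1 := H.bg true y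
    have a2 := H.bg false y
    have a3 := H.bg' true y
    have a4 := H.bg' false y
    have a5 := H.sb true y
    have a6 := H.sb false y
    have b1 := H'.bg true y
    have b2 := H'.bg false y
    have b3 := H'.bg' true y
    have b4 := H'.bg' false y
    have b5 := H'.sb true y
    have b6 := H'.sb false y
    have c1 := hs (i + 1) y
    have c2 := hs (i + 2) y
    split_ifs <;> omega
  · have e : ∀ T : Bool → ℕ → Fin (k + 1) → ℤ, ¬ DBT T y i → ∀ c, PassT T c y i ↔
        (N1 (cT T (i + 1)) (cT T (i + 2)) y ≤ AT T i y ∨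
          CT (cT T i) (cT T (i + 1)) (cT T (i + 2)) (AT T i) y) :=
      fun T hd c => ⟨fun hp => hp.2 hd, fun he => ⟨fun h => absurd h hd, fun hn => he⟩⟩
    rw [hA] at hCT
    simp only [e T hd, e T' (fun hh => hd (hDB.1 hh)), hCT, hN, hA]
end
end JT

namespace JT

section
variable {k : ℕ}

def IsChain (N : ℕ) (α γ : Fin (k + 1) → ℤ) (K : ℕ → Fin (k + 1) → ℤ) : Prop :=
  K 0 = α ∧ (∀ m, N ≤ m → K m = γ) ∧ (∀ m, StrictMono (K m)) ∧ ∀ m, Inter (K m) (K (m + 1))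

def PC (N : ℕ) (α γ : Bool → Fin (k + 1) → ℤ) (T : Bool → ℕ → Fin (k + 1) → ℤ) : Prop :=
  ∀ c, IsChain N (α c) (γ c) (T c)

lemma PC.vt {N : ℕ} {α γ : Bool → Fin (k + 1) → ℤ} {T : Bool → ℕ → Fin (k + 1) → ℤ}
    (h : PC N α γ T) : VT T := fun c m => ⟨(h c).2.2.1 m, (h c).2.2.2 m⟩

lemma PC.le {N : ℕ} {α γ : Bool → Fin (k + 1) → ℤ} {T : Bool → ℕ → Fin (k + 1) → ℤ}
    (h : PC N α γ T) (c : Bool) {m m' : ℕ} (hm : m ≤ m') (a : Fin (k + 1)) : T c m a ≤ T c m' a :=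
  monotone_nat_of_le_succ (f := fun m => T c m a) (fun m => (h.vt c m).2.1 a) hm

lemma PC.lo {N : ℕ} {α γ : Bool → Fin (k + 1) → ℤ} {T : Bool → ℕ → Fin (k + 1) → ℤ}
    (h : PC N α γ T) {lo : ℤ} (hlo : ∀ c a, lo ≤ α c a) (c : Bool) (m : ℕ) (a : Fin (k + 1)) :
    lo ≤ T c m a := by
  have := h.le c (Nat.zero_le m) a
  rw [(h c).1] at this
  exact (hlo c a).trans this

lemma PC.hi {N : ℕ} {α γ : Bool → Fin (k + 1) → ℤ} {T : Bool → ℕ → Fin (k + 1) → ℤ}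
    (h : PC N α γ T) {hi : ℤ} (hhi : ∀ c a, γ c a ≤ hi) (c : Bool) (m : ℕ) (a : Fin (k + 1)) :
    T c m a ≤ hi := by
  have := h.le c (le_max_left m N) a
  rw [(h c).2.1 _ (le_max_right m N)] at this
  exact this.trans (hhi c a)

lemma down_ind {P : ℤ → Prop} (hi : ℤ) (top : ∀ x, hi < x → P x) (step : ∀ x, P (x + 1) → P x) :
    ∀ x, P x := by
  have key : ∀ n : ℕ, ∀ x, hi < x + n → P x := by
    intro n
    induction n with
    | zero => intro x hx; exact top x (by simpa using hx)
    | succ n ih => intro x hx; exact step x (ih (x + 1) (by push_cast at hx; omega))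
  intro x
  exact key (hi - x + 1).toNat x (by omega)

lemma le_iff_cnt {K : Fin (k + 1) → ℤ} (hK : StrictMono K) (x : ℤ) (a : Fin (k + 1)) :
    x ≤ K a ↔ (k : ℤ) + 1 - a ≤ cnt K x := by
  rw [cnt_eq_card]
  have e1 : ((Finset.Ici a).card : ℤ) = (k : ℤ) + 1 - a := by
    rw [Fin.card_Ici]; have := a.2; omega
  have e2 : ((Finset.Ioi a).card : ℤ) = (k : ℤ) - a := by
    rw [Fin.card_Ioi]; have := a.2; omega
  constructor
  · intro h
    rw [← e1]
    have : Finset.Ici a ⊆ Finset.univ.filter fun b => x ≤ K b := by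
      intro b hb
      rw [Finset.mem_Ici] at hb
      exact Finset.mem_filter.2 ⟨Finset.mem_univ _, h.trans (hK.monotone hb)⟩
    exact_mod_cast Finset.card_le_card this
  · intro h
    by_contra hn
    have : (Finset.univ.filter fun b => x ≤ K b) ⊆ Finset.Ioi a := by
      intro b hb
      rw [Finset.mem_filter] at hb
      rw [Finset.mem_Ioi]
      by_contra hba
      exact hn (hb.2.trans (hK.monotone (not_lt.1 hba)))
    have h2 : ((Finset.univ.filter fun b => x ≤ K b).card : ℤ) ≤ (Finset.Ioi a).card := by
      exact_mod_cast Finset.card_le_card this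
    omega

lemma inter_of_cnt {K L : Fin (k + 1) → ℤ} (hK : StrictMono K) (hL : StrictMono L)
    (h1 : ∀ x, cnt K x ≤ cnt L x) (h2 : ∀ x, cnt L x ≤ cnt K (x + 1) + 1) : Inter K L := by
  refine ⟨fun a => ?_, fun a b hab => ?_⟩
  · rw [le_iff_cnt hL]
    exact ((le_iff_cnt hK _ a).1 le_rfl).trans (h1 _)
  · rw [← Int.add_one_le_iff, le_iff_cnt hK]
    have := (le_iff_cnt hL (L a) a).1 le_rfl
    have := h2 (L a)
    have : (a : ℕ) < b := hab
    omega

lemma eq_of_cnt {K L : Fin (k + 1) → ℤ} (hK : StrictMono K) (hL : StrictMono L)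
    (h1 : ∀ x, cnt K x = cnt L x) : K = L := by
  funext a
  apply le_antisymm
  · rw [le_iff_cnt hL, ← h1, ← le_iff_cnt hK]
  · rw [le_iff_cnt hK, h1, ← le_iff_cnt hL]

lemma eq_max_of_cnt {K L M : Fin (k + 1) → ℤ} (hK : StrictMono K) (hL : StrictMono L)
    (hM : StrictMono M) (h : ∀ x, cnt M x = max (cnt K x) (cnt L x)) :
    M = fun a => max (K a) (L a) := by
  funext a
  refine eq_of_forall_le_iff fun x => ?_
  rw [le_iff_cnt hM, h, le_max_iff, le_max_iff, le_iff_cnt hK, le_iff_cnt hL]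

lemma eq_min_of_cnt {K L M : Fin (k + 1) → ℤ} (hK : StrictMono K) (hL : StrictMono L)
    (hM : StrictMono M) (h : ∀ x, cnt M x = min (cnt K x) (cnt L x)) :
    M = fun a => min (K a) (L a) := by
  funext a
  refine eq_of_forall_le_iff fun x => ?_
  rw [le_iff_cnt hM, h, le_min_iff, le_min_iff, le_iff_cnt hK, le_iff_cnt hL]

lemma exists_row (f : ℤ → ℤ) (lo hi : ℤ) (h1 : ∀ x, f (x + 1) ≤ f x) (h2 : ∀ x, f x ≤ f (x + 1) + 1)
    (h3 : ∀ x, hi < x → f x = 0) (h4 : ∀ x, x ≤ lo → f x = k + 1) :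
    ∃ K : Fin (k + 1) → ℤ, StrictMono K ∧ ∀ x, cnt K x = f x := by
  classical
  obtain ⟨R, hR⟩ : ∃ R, R = (Finset.Icc lo hi).filter (fun y => f y = f (y + 1) + 1) := ⟨_, rfl⟩
  have hcard : ∀ x, f x = ((R.filter fun y => x ≤ y).card : ℤ) := by
    refine down_ind hi ?_ ?_
    · intro x hx
      rw [h3 x hx, Finset.filter_false_of_mem]
      · simp
      · intro y hy
        rw [hR, Finset.mem_filter, Finset.mem_Icc] at hy
        omega
    · intro x ih
      have hd : R.filter (fun y => x ≤ y) = (if f x = f (x + 1) + 1 then {x} else ∅) ∪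
          R.filter (fun y => x + 1 ≤ y) := by
        ext y
        rw [Finset.mem_union, Finset.mem_filter (s := R), Finset.mem_filter (s := R)]
        constructor
        · rintro ⟨ha, hb⟩
          by_cases hxy : y = x
          · subst hxy
            rw [hR, Finset.mem_filter] at ha
            left; rw [if_pos ha.2]; simp
          · right; exact ⟨ha, by omega⟩
        · rintro (ha | ha)
          · split_ifs at ha with hc
            · rw [Finset.mem_singleton] at ha
              subst ha
              refine ⟨?_, le_rfl⟩
              rw [hR, Finset.mem_filter, Finset.mem_Icc]
              refine ⟨⟨?_, ?_⟩, hc⟩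
              · by_contra hlt
                have e1 := h4 y (by omega)
                have e2 := h4 (y + 1) (by omega)
                omega
              · by_contra hlt
                have e1 := h3 y (by omega)
                have e2 := h3 (y + 1) (by omega)
                omega
            · simp at ha
          · exact ⟨ha.1, by omega⟩
      rw [hd, Finset.card_union_of_disjoint]
      · push_cast
        rw [← ih]
        have a1 := h1 x
        have a2 := h2 x
        split_ifs with hc
        · simp; omega
        · simp; omega
      · rw [Finset.disjoint_left]
        intro y hy hy2
        rw [Finset.mem_filter] at hy2
        split_ifs at hy with hc
        · rw [Finset.mem_singleton] at hy; omega
        · simp at hy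
  have hRc : R.card = k + 1 := by
    have := hcard lo
    rw [h4 lo le_rfl, Finset.filter_true_of_mem] at this
    · exact_mod_cast this.symm
    · intro y hy
      rw [hR, Finset.mem_filter, Finset.mem_Icc] at hy
      exact hy.1.1
  refine ⟨R.orderEmbOfFin hRc, (R.orderEmbOfFin hRc).strictMono, fun x => ?_⟩
  rw [hcard x, cnt_eq_card]
  congr 1
  refine Finset.card_bij (fun a _ => R.orderEmbOfFin hRc a) ?_ ?_ ?_
  · intro a ha
    rw [Finset.mem_filter] at ha ⊢
    exact ⟨Finset.orderEmbOfFin_mem _ _ _, ha.2⟩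
  · intro a _ b _ hab
    exact (R.orderEmbOfFin hRc).injective hab
  · intro y hy
    rw [Finset.mem_filter] at hy
    have : y ∈ Set.range (R.orderEmbOfFin hRc) := by
      rw [Finset.range_orderEmbOfFin]; exact hy.1
    obtain ⟨a, rfl⟩ := this
    exact ⟨a, Finset.mem_filter.2 ⟨Finset.mem_univ _, hy.2⟩, rfl⟩

/-- relation between values at two adjacent nodes -/
def Rl (p0 q0 p q p' q' : ℤ) : Prop :=
  (p0 + q0 < 0 → p' - q' = -(p - q)) ∧ (0 ≤ p0 + q0 → p' - q' = p - q)

def Nb (p0 q0 p q : ℤ) : Prop :=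
  (p - q = p0 - q0 ∨ p - q = -(p0 - q0)) ∧ -1 ≤ p0 - q0 ∧ p0 - q0 ≤ 1

lemma Nb.symm {p0 q0 p q : ℤ} (h : Nb p0 q0 p q) : Nb q0 p0 q p := by unfold Nb at *; omega
lemma Rl.symm {p0 q0 p q p' q' : ℤ} (h : Rl p0 q0 p q p' q') : Rl q0 p0 q p q' p' := by
  unfold Rl at *; omega

lemma tri {u0 v0 w0 u v w u' v' w' : ℤ} (n1 : Nb u0 v0 u v) (n2 : Nb v0 w0 v w) (n3 : Nb u0 w0 u w)
    (r1 : Rl u0 v0 u v u' v') (r2 : Rl v0 w0 v w v' w') : Rl u0 w0 u w u' w' := by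
  unfold Nb Rl at *
  omega

def eT (T : Bool → ℕ → Fin (k + 1) → ℤ) (m : ℕ) (c : Bool) (x : ℤ) : ℤ :=
  cT T m c x - cT T m c (x + 1)

def dT (T : Bool → ℕ → Fin (k + 1) → ℤ) (m : ℕ) (x : ℤ) : ℤ := cT T m true x - cT T m false x

def Flip (T : Bool → ℕ → Fin (k + 1) → ℤ) (m : ℕ) (x : ℤ) : Prop := dT T m x + dT T m (x + 1) < 0

def up (α : Bool → Fin (k + 1) → ℤ) (c : Bool) : Fin (k + 1) → ℤ :=
  fun a => if c then max (α true a) (α false a) else min (α true a) (α false a)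

open Classical in
lemma exists_flip {N : ℕ} {α γ : Bool → Fin (k + 1) → ℤ} {T0 T : Bool → ℕ → Fin (k + 1) → ℤ}
    (h0 : PC N α γ T0) (h : PC N α γ T) (hs : SameS T0 T) :
    ∃ T', PC N (up α) (up γ) T' ∧ SameS T T' ∧
      ∀ m c x, eT T' m c x = if Flip T0 m x then eT T m (!c) x else eT T m c x := by
  obtain ⟨lo, hlo⟩ : ∃ lo : ℤ, ∀ c a, lo ≤ α c a := by
    obtain ⟨M, hM⟩ := exists_bound (fun a => - α true a)
    obtain ⟨M', hM'⟩ := exists_bound (fun a => - α false a)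
    refine ⟨-(|M| + |M'|), ?_⟩
    have := le_abs_self M
    have := le_abs_self M'
    have := abs_nonneg M
    have := abs_nonneg M'
    rw [Bool.forall_bool]
    constructor <;> intro a
    · have := hM' a; linarith
    · have := hM a; linarith
  obtain ⟨hi, hhi⟩ : ∃ hi : ℤ, ∀ c a, γ c a ≤ hi := by
    obtain ⟨M, hM⟩ := exists_bound (γ true)
    obtain ⟨M', hM'⟩ := exists_bound (γ false)
    refine ⟨(|M| + |M'|), ?_⟩
    have := le_abs_self M
    have := le_abs_self M'
    have := abs_nonneg M
    have := abs_nonneg M'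
    rw [Bool.forall_bool]
    constructor <;> intro a
    · have := hM' a; linarith
    · have := hM a; linarith
  have l0 := h0.lo hlo
  have l1 := h.lo hlo
  have u0 := h0.hi hhi
  have u1 := h.hi hhi
  have top0 : ∀ m c x, hi < x → cT T0 m c x = 0 :=
    fun m c x hx => cnt_eq_zero _ fun a => (u0 c m a).trans_lt hx
  have top1 : ∀ m c x, hi < x → cT T m c x = 0 :=
    fun m c x hx => cnt_eq_zero _ fun a => (u1 c m a).trans_lt hx
  have bot0 : ∀ m c x, x ≤ lo → cT T0 m c x = k + 1 :=
    fun m c x hx => by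
      have := cnt_eq_k (T0 c m) fun a => hx.trans (l0 c m a)
      push_cast at this
      exact this
  have bot1 : ∀ m c x, x ≤ lo → cT T m c x = k + 1 :=
    fun m c x hx => by
      have := cnt_eq_k (T c m) fun a => hx.trans (l1 c m a)
      push_cast at this
      exact this
  set E : ℕ → Bool → ℤ → ℤ := fun m c x => if Flip T0 m x then eT T m (!c) x else eT T m c x with hE
  set f : ℕ → Bool → ℤ → ℤ := fun m c x => ∑ y ∈ Finset.Icc x hi, E m c y with hf
  have ftop : ∀ m c x, hi < x → f m c x = 0 := by
    intro m c x hx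
    simp only [hf]
    rw [Finset.Icc_eq_empty (not_le.2 hx), Finset.sum_empty]
  have fstep : ∀ m c x, f m c x - f m c (x + 1) = E m c x := by
    intro m c x
    by_cases hx : x ≤ hi
    · have : Finset.Icc x hi = insert x (Finset.Icc (x + 1) hi) := by
        ext y; simp only [Finset.mem_insert, Finset.mem_Icc]; omega
      simp only [hf]
      rw [this, Finset.sum_insert (by simp)]
      ring
    · rw [ftop _ _ _ (by omega), ftop _ _ _ (by omega)]
      simp only [hE, eT]
      rw [top1 _ _ _ (by omega), top1 _ _ _ (by omega), top1 _ _ _ (by omega), top1 _ _ _ (by omega)]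
      simp
  -- sums are preserved
  have fs : ∀ m x, f m true x + f m false x = cT T m true x + cT T m false x := by
    intro m
    refine down_ind hi ?_ ?_
    · intro x hx
      rw [ftop _ _ _ hx, ftop _ _ _ hx, top1 _ _ _ hx, top1 _ _ _ hx]
    · intro x ih
      have a1 := fstep m true x
      have a2 := fstep m false x
      simp only [hE, eT, Bool.not_true, Bool.not_false] at a1 a2
      split_ifs at a1 a2 <;> omega
  -- basic inequalities
  have hor : ∀ T : Bool → ℕ → Fin (k + 1) → ℤ, PC N α γ T → ∀ m c x,
      cT T m c (x + 1) ≤ cT T m c x ∧ cT T m c x ≤ cT T m c (x + 1) + 1 := fun T h m c x =>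
    ⟨cnt_anti _ (by omega), cnt_le' (Inter.refl (h.vt c m).1) x⟩
  have ver : ∀ T : Bool → ℕ → Fin (k + 1) → ℤ, PC N α γ T → ∀ m c x,
      cT T m c x ≤ cT T (m + 1) c x ∧ cT T (m + 1) c x ≤ cT T m c (x + 1) + 1 := fun T h m c x =>
    ⟨cnt_le (h.vt c m).2 x, cnt_le' (h.vt c m).2 x⟩
  have nbH : ∀ m x, Nb (dT T0 m x) (dT T0 m (x + 1)) (dT T m x) (dT T m (x + 1)) := by
    intro m x
    have := hor T h m true x
    have := hor T h m false x
    have := hor T0 h0 m true x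
    have := hor T0 h0 m false x
    have := hs m x
    have := hs m (x + 1)
    unfold Nb dT
    omega
  have nbV : ∀ m x, Nb (dT T0 m x) (dT T0 (m + 1) x) (dT T m x) (dT T (m + 1) x) := by
    intro m x
    have := hor T h m true x
    have := hor T h m false x
    have := hor T0 h0 m true x
    have := hor T0 h0 m false x
    have := ver T h m true x
    have := ver T h m false x
    have := ver T0 h0 m true x
    have := ver T0 h0 m false x
    have := hs m x
    have := hs (m + 1) x
    unfold Nb dT
    omega
  have nbD : ∀ m x, Nb (dT T0 (m + 1) x) (dT T0 m (x + 1)) (dT T (m + 1) x) (dT T m (x + 1)) := by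
    intro m x
    have := hor T h m true x
    have := hor T h m false x
    have := hor T0 h0 m true x
    have := hor T0 h0 m false x
    have := ver T h m true x
    have := ver T h m false x
    have := ver T0 h0 m true x
    have := ver T0 h0 m false x
    have := hs m (x + 1)
    have := hs (m + 1) x
    unfold Nb dT
    omega
  set d' : ℕ → ℤ → ℤ := fun m x => f m true x - f m false x with hd'
  have rH : ∀ m x, Rl (dT T0 m x) (dT T0 m (x + 1)) (dT T m x) (dT T m (x + 1)) (d' m x)
      (d' m (x + 1)) := by
    intro m x
    have a1 := fstep m true x
    have a2 := fstep m false x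
    simp only [hE, eT, Bool.not_true, Bool.not_false, Flip] at a1 a2
    simp only [Rl, hd']
    constructor
    · intro hlt
      rw [if_pos hlt] at a1 a2
      unfold dT; omega
    · intro hlt
      rw [if_neg (not_lt.2 hlt)] at a1 a2
      unfold dT; omega
  have rD_of : ∀ m x, Rl (dT T0 m (x + 1)) (dT T0 (m + 1) (x + 1)) (dT T m (x + 1))
      (dT T (m + 1) (x + 1)) (d' m (x + 1)) (d' (m + 1) (x + 1)) →
      Rl (dT T0 (m + 1) x) (dT T0 m (x + 1)) (dT T (m + 1) x) (dT T m (x + 1))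
        (d' (m + 1) x) (d' m (x + 1)) := fun m x hr =>
    tri (nbH (m + 1) x) (nbV m (x + 1)).symm (nbD m x) (rH (m + 1) x) hr.symm
  have rV : ∀ m x, Rl (dT T0 m x) (dT T0 (m + 1) x) (dT T m x) (dT T (m + 1) x) (d' m x)
      (d' (m + 1) x) := by
    intro m
    refine down_ind hi ?_ ?_
    · intro x hx
      simp only [hd', dT]
      rw [ftop _ _ _ hx, ftop _ _ _ hx, ftop _ _ _ hx, ftop _ _ _ hx, top1 _ _ _ hx, top1 _ _ _ hx,
        top1 _ _ _ hx, top1 _ _ _ hx]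
      simp [Rl]
    · intro x ih
      exact tri (nbH m x) (nbD m x).symm (nbV m x) (rH m x) (rD_of m x ih).symm
  have rD := fun m x => rD_of m x (rV m (x + 1))
  -- rows where T and T0 agree
  have rowabs : ∀ m, (∀ c, T0 c m = T c m) → ∀ x, d' m x = |dT T m x| := by
    intro m hm
    have e : ∀ x, dT T0 m x = dT T m x := by
      intro x; simp only [dT, cT, hm]
    refine down_ind hi ?_ ?_
    · intro x hx
      simp only [hd', dT]
      rw [ftop _ _ _ hx, ftop _ _ _ hx, top1 _ _ _ hx, top1 _ _ _ hx]
      simp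
    · intro x ih
      have a1 := rH m x
      have a2 := nbH m x
      rw [e, e] at a1 a2
      unfold Rl at a1
      unfold Nb at a2
      rcases abs_cases (dT T m x) with q | q <;> rcases abs_cases (dT T m (x + 1)) with q' | q' <;>
        omega
  have agree0 : ∀ c, T0 c 0 = T c 0 := fun c => by rw [(h0 c).1, (h c).1]
  have agreeN : ∀ m, N ≤ m → ∀ c, T0 c m = T c m := fun m hm c => by
    rw [(h0 c).2.1 m hm, (h c).2.1 m hm]
  -- bottom
  have dbot : ∀ m x, x ≤ lo → d' m x = 0 := by
    intro m x hx
    have z0 : ∀ m, dT T0 m x = 0 := fun m => by unfold dT; rw [bot0 _ _ _ hx, bot0 _ _ _ hx]; ring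
    have z1 : ∀ m, dT T m x = 0 := fun m => by unfold dT; rw [bot1 _ _ _ hx, bot1 _ _ _ hx]; ring
    induction m with
    | zero => rw [rowabs 0 agree0, z1]; rfl
    | succ m ih =>
      have := rV m x
      rw [z0, z0, z1, z1, ih] at this
      unfold Rl at this
      omega
  have fbot : ∀ m c x, x ≤ lo → f m c x = k + 1 := by
    intro m c x hx
    have a1 := dbot m x hx
    have a2 := fs m x
    rw [bot1 _ _ _ hx, bot1 _ _ _ hx] at a2
    simp only [hd'] at a1
    cases c <;> omega
  have fhor : ∀ m c x, f m c (x + 1) ≤ f m c x ∧ f m c x ≤ f m c (x + 1) + 1 := by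
    intro m c x
    have a1 := fstep m c x
    simp only [hE, eT] at a1
    have := hor T h m c x
    have := hor T h m (!c) x
    split_ifs at a1 <;> omega
  have fver : ∀ m c x, f m c x ≤ f (m + 1) c x := by
    intro m c x
    have a1 := rV m x
    have a2 := fs m x
    have a3 := fs (m + 1) x
    have a4 := ver T h m true x
    have a5 := ver T h m false x
    simp only [hd', dT, Rl] at a1
    cases c <;> omega
  have fdia : ∀ m c x, f (m + 1) c x ≤ f m c (x + 1) + 1 := by
    intro m c x
    have a1 := rD m x
    have a2 := fs m (x + 1)
    have a3 := fs (m + 1) x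
    have a4 := ver T h m true x
    have a5 := ver T h m false x
    simp only [hd', dT, Rl] at a1
    cases c <;> omega
  choose T' hT' using fun c m => exists_row (k := k) (f m c) lo hi (fun x => (fhor m c x).1)
    (fun x => (fhor m c x).2) (ftop m c) (fbot m c)
  have hcT : ∀ m c x, cT T' m c x = f m c x := fun m c x => (hT' c m).2 x
  have hrow : ∀ m, (∀ c, T0 c m = T c m) → ∀ c, T' c m = up (fun c => T c m) c := by
    intro m hm c
    have sT : ∀ c, StrictMono (T c m) := fun c => (h.vt c m).1
    cases c
    · have := eq_min_of_cnt (sT true) (sT false) (hT' false m).1 (fun x => by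
        rw [(hT' false m).2 x]
        have a1 := rowabs m hm x
        have a2 := fs m x
        simp only [hd', dT, cT] at a1 a2
        rcases abs_cases (cnt (T true m) x - cnt (T false m) x) with q | q <;> omega)
      rw [this]; funext a; simp [up]
    · have := eq_max_of_cnt (sT true) (sT false) (hT' true m).1 (fun x => by
        rw [(hT' true m).2 x]
        have a1 := rowabs m hm x
        have a2 := fs m x
        simp only [hd', dT, cT] at a1 a2
        rcases abs_cases (cnt (T true m) x - cnt (T false m) x) with q | q <;> omega)
      rw [this]; funext a; simp [up]
  refine ⟨T', fun c => ⟨?_, ?_, fun m => (hT' c m).1, fun m => ?_⟩, ?_, ?_⟩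
  · rw [hrow 0 agree0]
    congr 1
    funext c
    exact (h c).1
  · intro m hm
    rw [hrow m (agreeN m hm)]
    congr 1
    funext c
    exact (h c).2.1 m hm
  · refine inter_of_cnt (hT' c m).1 (hT' c (m + 1)).1 (fun x => ?_) (fun x => ?_)
    · rw [(hT' c m).2, (hT' c (m + 1)).2]; exact fver m c x
    · rw [(hT' c m).2, (hT' c (m + 1)).2]; exact fdia m c x
  · intro m x
    rw [hcT, hcT, fs]
  · intro m c x
    unfold eT
    rw [hcT, hcT, fstep]
    rfl

lemma eT_inj {N : ℕ} {α γ : Bool → Fin (k + 1) → ℤ} {T1 T2 : Bool → ℕ → Fin (k + 1) → ℤ}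
    (h1 : PC N α γ T1) (h2 : PC N α γ T2) (he : ∀ m c x, eT T1 m c x = eT T2 m c x) : T1 = T2 := by
  funext c m
  refine eq_of_cnt (h1.vt c m).1 (h2.vt c m).1 ?_
  obtain ⟨M, hM⟩ := exists_bound (T1 c m)
  obtain ⟨M', hM'⟩ := exists_bound (T2 c m)
  refine down_ind (max M M') ?_ ?_
  · intro x hx
    rw [max_lt_iff] at hx
    rw [cnt_eq_zero _ fun a => (hM a).trans_lt hx.1, cnt_eq_zero _ fun a => (hM' a).trans_lt hx.2]
  · intro x ih
    have := he m c x
    unfold eT cT at this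
    linarith

lemma SameS.symm {T T' : Bool → ℕ → Fin (k + 1) → ℤ} (h : SameS T T') : SameS T' T :=
  fun m x => (h m x).symm

lemma SameS.trans {T T' T'' : Bool → ℕ → Fin (k + 1) → ℤ} (h : SameS T T') (h' : SameS T' T'') :
    SameS T T'' := fun m x => (h' m x).trans (h m x)

lemma exists_injection (N : ℕ) (α γ : Bool → Fin (k + 1) → ℤ) :
    ∃ Φ : (Bool → ℕ → Fin (k + 1) → ℤ) → (Bool → ℕ → Fin (k + 1) → ℤ),
      (∀ T, PC N α γ T → PC N (up α) (up γ) (Φ T) ∧ SameS T (Φ T)) ∧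
      ∀ T1 T2, PC N α γ T1 → PC N α γ T2 → Φ T1 = Φ T2 → T1 = T2 := by
  classical
  let st : Setoid {T : Bool → ℕ → Fin (k + 1) → ℤ // PC N α γ T} :=
    { r := fun T T' => SameS T.1 T'.1
      iseqv := ⟨fun _ _ _ => rfl, fun h => h.symm, fun h h' => h.trans h'⟩ }
  have hrep : ∀ T : {T : Bool → ℕ → Fin (k + 1) → ℤ // PC N α γ T},
      SameS (Quotient.mk st T).out.1 T.1 := fun T => Quotient.mk_out (s := st) T
  choose F hF using fun T : {T : Bool → ℕ → Fin (k + 1) → ℤ // PC N α γ T} =>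
    exists_flip (Quotient.mk st T).out.2 T.2 (hrep T)
  refine ⟨fun T => if h : PC N α γ T then F ⟨T, h⟩ else T, fun T hT => ?_, fun T1 T2 h1 h2 he => ?_⟩
  · simp only [dif_pos hT]
    exact ⟨(hF ⟨T, hT⟩).1, (hF ⟨T, hT⟩).2.1⟩
  · simp only at he
    rw [dif_pos h1, dif_pos h2] at he
    have q1 := hF ⟨T1, h1⟩
    have q2 := hF ⟨T2, h2⟩
    have hs : SameS T1 T2 := by
      refine q1.2.1.trans ?_
      rw [he]
      exact q2.2.1.symm
    have hq : Quotient.mk st ⟨T1, h1⟩ = Quotient.mk st ⟨T2, h2⟩ := Quotient.sound hs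
    refine eT_inj h1 h2 fun m c x => ?_
    have a1 := q1.2.2 m
    have a2 := q2.2.2 m
    rw [he, hq] at a1
    by_cases hfl : Flip (Quotient.mk st ⟨T2, h2⟩).out.1 m x
    · have b1 := a1 (!c) x
      have b2 := a2 (!c) x
      rw [if_pos hfl, Bool.not_not] at b1 b2
      rw [← b1, ← b2]
    · have b1 := a1 c x
      have b2 := a2 c x
      rw [if_neg hfl] at b1 b2
      rw [← b1, ← b2]
end
end JT

namespace JT
open Finset
section
variable {R : Type*} [CommRing R]

lemma hsymm_eq_coeff (N m : ℕ) : MvPolynomial.hsymm (Fin N) ℤ m =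
    PowerSeries.coeff m (∏ i : Fin N, PowerSeries.mk (fun j => (MvPolynomial.X i : MvPolynomial (Fin N) ℤ) ^ j)) := by
  classical
  rw [PowerSeries.coeff_prod, MvPolynomial.hsymm]
  refine Finset.sum_nbij (fun s => Multiset.toFinsupp s.1) ?_ ?_ ?_ ?_
  · intro s _
    rw [mem_finsuppAntidiag]
    refine ⟨?_, Finset.subset_univ _⟩
    have h2 := s.2
    have h3 := Multiset.sum_count_eq_card (s := Finset.univ) (m := (s : Multiset (Fin N))) (fun a _ => Finset.mem_univ a)
    exact h3.trans h2
  · intro s _ t _ h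
    exact Subtype.ext (Multiset.toFinsupp.injective h)
  · intro f hf
    rw [mem_coe, mem_finsuppAntidiag] at hf
    refine ⟨⟨Finsupp.toMultiset f, ?_⟩, Finset.mem_coe.2 (Finset.mem_univ _), ?_⟩
    · rw [Finsupp.card_toMultiset, Finsupp.sum_fintype _ _ (fun _ => rfl)]
      exact hf.1
    · simp
  · intro s _
    rw [Finset.prod_multiset_map_count]
    refine Finset.prod_subset_one_on_sdiff (Finset.subset_univ _) ?_ ?_
    · intro i hi
      simp at hi
      simp [hi]
    · intro i _
      simp

noncomputable def PSn (x : ℕ → R) (n : ℕ) : PowerSeries R :=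
  ∏ j ∈ Finset.range n, PowerSeries.mk (fun m => x j ^ m)

noncomputable def Hh (x : ℕ → R) (n : ℕ) (m : ℤ) : R :=
  if 0 ≤ m then PowerSeries.coeff m.toNat (PSn x n) else 0

lemma geom_mul (a : R) : (1 - PowerSeries.C a * PowerSeries.X) * PowerSeries.mk (fun m => a ^ m) = 1 := by
  ext m
  rw [sub_mul, one_mul, mul_assoc, map_sub, PowerSeries.coeff_C_mul]
  cases m with
  | zero => simp
  | succ m =>
    rw [PowerSeries.coeff_succ_X_mul, PowerSeries.coeff_mk, PowerSeries.coeff_mk, PowerSeries.coeff_one]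
    simp [pow_succ']

lemma Hh_neg (x : ℕ → R) (n : ℕ) {m : ℤ} (hm : m < 0) : Hh x n m = 0 := by
  rw [Hh, if_neg (by omega)]

lemma PSn_rec (x : ℕ → R) (n : ℕ) :
    PSn x (n + 1) = PSn x n + PowerSeries.C (x n) * (PowerSeries.X * PSn x (n + 1)) := by
  have h := geom_mul (x n)
  have e : PSn x (n + 1) = PSn x n * PowerSeries.mk (fun m => x n ^ m) := by
    rw [PSn, Finset.prod_range_succ, ← PSn]
  rw [e]
  linear_combination (PSn x n) * h

lemma Hh_rec (x : ℕ → R) (n : ℕ) (m : ℤ) : Hh x (n + 1) m = Hh x n m + x n * Hh x (n + 1) (m - 1) := by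
  rcases lt_or_ge m 0 with hm | hm
  · rw [Hh_neg _ _ hm, Hh_neg _ _ hm, Hh_neg _ _ (by omega)]; simp
  · obtain ⟨p, rfl⟩ := Int.eq_ofNat_of_zero_le hm
    have h := congrArg (PowerSeries.coeff p) (PSn_rec x n)
    rw [map_add, PowerSeries.coeff_C_mul] at h
    cases p with
    | zero =>
      rw [Hh_neg x (n + 1) (m := ((0 : ℕ) : ℤ) - 1) (by simp)]
      simp [Hh] at h ⊢
      exact h
    | succ p =>
      rw [PowerSeries.coeff_succ_X_mul] at h
      have : ((p + 1 : ℕ) : ℤ) - 1 = p := by push_cast; ring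
      rw [this]
      simp only [Hh, Int.toNat_natCast]
      rw [if_pos (by positivity), if_pos (by positivity), if_pos (by positivity)]
      exact h

lemma Hh_zero (x : ℕ → R) (m : ℤ) : Hh x 0 m = if m = 0 then 1 else 0 := by
  rcases lt_trichotomy m 0 with hm | hm | hm
  · rw [Hh_neg _ _ hm, if_neg (by omega)]
  · subst hm; simp [Hh, PSn]
  · rw [Hh, if_pos hm.le, if_neg (by omega), PSn, Finset.prod_range_zero, PowerSeries.coeff_one, if_neg (by omega)]

lemma Hh_sum (x : ℕ → R) (n : ℕ) (α g' g : ℤ) (h : g' ≤ g) :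
    Hh x (n + 1) (g - α) = ∑ β ∈ Finset.Ioc g' g, x n ^ (g - β).toNat * Hh x n (β - α)
      + x n ^ (g - g').toNat * Hh x (n + 1) (g' - α) := by
  induction g, h using Int.leInduction with
  | base => simp
  | succ g hg ih =>
    rw [Hh_rec, show g + 1 - α - 1 = g - α by ring, ih]
    have hI : Finset.Ioc g' (g + 1) = insert (g + 1) (Finset.Ioc g' g) := by
      ext y; simp only [Finset.mem_Ioc, Finset.mem_insert]; omega
    rw [hI, Finset.sum_insert (by simp), mul_add, Finset.mul_sum, ← add_assoc]
    congr 1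
    · congr 1
      · simp
      · refine Finset.sum_congr rfl fun β hβ => ?_
        rw [Finset.mem_Ioc] at hβ
        rw [show (g + 1 - β).toNat = (g - β).toNat + 1 by omega, pow_succ']; ring
    · rw [show (g + 1 - g').toNat = (g - g').toNat + 1 by omega, pow_succ']; ring

variable {k : ℕ}

noncomputable def preS (lo : ℤ) (γ : Fin (k + 1) → ℤ) (a : Fin (k + 1)) : Finset ℤ :=
  Finset.Ioc (Fin.cases (lo - 1) (fun i => γ i.castSucc) a) (γ a)

lemma det_step (x : ℕ → R) (n : ℕ) (lo : ℤ) (α γ : Fin (k + 1) → ℤ) (hlo : ∀ b, lo ≤ α b) (hγ : Monotone γ) :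
    Matrix.det (Matrix.of fun a b => Hh x (n + 1) (γ a - α b)) =
      ∑ β ∈ Fintype.piFinset (preS lo γ), (∏ a, x n ^ (γ a - β a).toNat) *
        Matrix.det (Matrix.of fun a b => Hh x n (β a - α b)) := by
  classical
  have h1 : Matrix.det (Matrix.of fun a b => Hh x (n + 1) (γ a - α b)) =
      Matrix.det (Matrix.of fun a b => ∑ β ∈ preS lo γ a, x n ^ (γ a - β).toNat * Hh x n (β - α b)) := by
    refine Matrix.det_eq_of_forall_row_eq_smul_add_pred (fun i => x n ^ (γ i.succ - γ i.castSucc).toNat) ?_ ?_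
    · intro b
      simp only [Matrix.of_apply, preS, Fin.cases_zero]
      rcases le_or_gt (lo - 1) (γ 0) with h | h
      · rw [Hh_sum x n (α b) (lo - 1) (γ 0) h, Hh_neg x (n + 1) (by have := hlo b; omega)]; simp
      · rw [Hh_neg _ _ (by have := hlo b; omega), Finset.Ioc_eq_empty (by omega)]; simp
    · intro i b
      simp only [Matrix.of_apply, preS, Fin.cases_succ]
      exact Hh_sum x n (α b) _ _ (hγ i.castSucc_le_succ)
  rw [h1]
  have h2 : (Matrix.of fun a b => ∑ β ∈ preS lo γ a, x n ^ (γ a - β).toNat * Hh x n (β - α b) :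
      Matrix (Fin (k + 1)) (Fin (k + 1)) R) =
      fun a => ∑ β ∈ preS lo γ a, x n ^ (γ a - β).toNat • fun b => Hh x n (β - α b) := by
    funext a b
    simp [Finset.sum_apply]
  rw [h2]
  have h3 := (Matrix.detRowAlternating (n := Fin (k + 1)) (R := R)).toMultilinearMap.map_sum_finset
    (fun a (β : ℤ) => x n ^ (γ a - β).toNat • fun b => Hh x n (β - α b)) (preS lo γ)
  refine h3.trans (Finset.sum_congr rfl fun β _ => ?_)
  rw [MultilinearMap.map_smul_univ, smul_eq_mul]
  rfl

lemma det_base (x : ℕ → R) (α γ : Fin (k + 1) → ℤ) (hα : Monotone α) (hγ : Monotone γ) :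
    Matrix.det (Matrix.of fun a b => Hh x 0 (γ a - α b)) = if α = γ ∧ StrictMono γ then 1 else 0 := by
  classical
  by_cases h1 : Function.Injective γ
  swap
  · have hn : ¬ StrictMono γ := fun h => h1 h.injective
    rw [if_neg (by tauto)]
    simp only [Function.Injective, not_forall] at h1
    obtain ⟨a, b, hab, hne⟩ := h1
    refine Matrix.det_zero_of_row_eq hne ?_
    funext j; simp [hab]
  by_cases h2 : Function.Injective α
  swap
  · rw [if_neg (by rintro ⟨rfl, h⟩; exact h2 h.injective)]
    simp only [Function.Injective, not_forall] at h2
    obtain ⟨a, b, hab, hne⟩ := h2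
    refine Matrix.det_zero_of_column_eq hne ?_
    intro j; simp [hab]
  have s1 := hγ.strictMono_of_injective h1
  have s2 := hα.strictMono_of_injective h2
  by_cases he : α = γ
  · subst he
    rw [if_pos ⟨rfl, s1⟩]
    have : (Matrix.of fun a b => Hh x 0 (α a - α b)) = (1 : Matrix (Fin (k + 1)) (Fin (k + 1)) R) := by
      ext a b
      rw [Matrix.of_apply, Hh_zero, Matrix.one_apply]
      refine if_congr ?_ rfl rfl
      rw [sub_eq_zero]; exact h2.eq_iff
    rw [this, Matrix.det_one]
  · rw [if_neg (by tauto)]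
    by_cases hz : ∃ a, ∀ b, γ a ≠ α b
    · obtain ⟨a, ha⟩ := hz
      refine Matrix.det_eq_zero_of_row_eq_zero a fun b => ?_
      rw [Matrix.of_apply, Hh_zero, if_neg]
      rw [sub_eq_zero]; exact ha b
    · exfalso
      push Not at hz
      choose σ hσ using hz
      have hi : Function.Injective σ := fun a b hab => h1 (by rw [hσ, hσ, hab])
      have hs : Function.Surjective σ := Finite.surjective_of_injective hi
      apply he
      refine (StrictMono.range_inj s2 s1).1 ?_
      ext y
      constructor
      · rintro ⟨b, rfl⟩
        obtain ⟨a, rfl⟩ := hs b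
        exact ⟨a, hσ a⟩
      · rintro ⟨a, rfl⟩
        exact ⟨σ a, (hσ a).symm⟩

noncomputable def wtx (x : ℕ → R) (n : ℕ) (K : ℕ → Fin (k + 1) → ℤ) : R :=
  ∏ m ∈ Finset.range n, x m ^ (∑ a, K (m + 1) a - ∑ a, K m a).toNat

lemma lgv (x : ℕ → R) (α : Fin (k + 1) → ℤ) (hα : Monotone α) (n : ℕ) : ∀ γ : Fin (k + 1) → ℤ,
    ∃ S : Finset (ℕ → Fin (k + 1) → ℤ), Monotone γ → (∀ K, K ∈ S ↔ IsChain n α γ K) ∧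
      Matrix.det (Matrix.of fun a b => Hh x n (γ a - α b)) = ∑ K ∈ S, wtx x n K := by
  classical
  induction n with
  | zero =>
    intro γ
    refine ⟨if α = γ ∧ StrictMono γ then {fun _ => γ} else ∅, fun hγ => ⟨?_, ?_⟩⟩
    · intro K
      split_ifs with h
      · rw [Finset.mem_singleton]
        constructor
        · rintro rfl
          exact ⟨h.1.symm, fun _ _ => rfl, fun _ => h.2, fun _ => ⟨fun _ => le_rfl, fun a b hab => h.2 hab⟩⟩
        · rintro hK
          funext m
          exact hK.2.1 m (Nat.zero_le _)
      · simp only [Finset.notMem_empty, false_iff]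
        intro hK
        have e := hK.2.1 0 le_rfl
        exact h ⟨by rw [← e, hK.1], e ▸ hK.2.2.1 0⟩
    · rw [det_base x α γ hα hγ]
      split_ifs with h
      · simp [wtx]
      · simp
  | succ n ih =>
    intro γ
    choose S hS using ih
    obtain ⟨lo, hlo⟩ : ∃ lo : ℤ, ∀ b, lo ≤ α b := ⟨α 0, fun b => hα (Fin.zero_le b)⟩
    have hpre : ∀ β ∈ Fintype.piFinset (preS lo γ), Inter β γ ∧ StrictMono β := by
      intro β hβ
      rw [Fintype.mem_piFinset] at hβ
      have q1 : ∀ a, β a ≤ γ a := fun a => (Finset.mem_Ioc.1 (hβ a)).2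
      have q2 : ∀ i : Fin k, γ i.castSucc < β i.succ := fun i => by
        have := (Finset.mem_Ioc.1 (hβ i.succ)).1
        simpa using this
      have hsβ : StrictMono β := Fin.strictMono_iff_lt_succ.2 fun i => (q1 _).trans_lt (q2 i)
      refine ⟨⟨q1, fun a b hab => ?_⟩, hsβ⟩
      obtain ⟨i, rfl⟩ : ∃ i : Fin k, b = i.succ := Fin.exists_succ_eq.2 (by rintro rfl; exact absurd hab (Fin.not_lt_zero _)) |>.imp fun _ h => h.symm
      have hle : a ≤ i.castSucc := Fin.le_castSucc_iff.2 hab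
      have hsγ : StrictMono γ := Fin.strictMono_iff_lt_succ.2 fun i => (q2 i).trans_le (q1 _)
      exact (hsγ.monotone hle).trans_lt (q2 i)
    let P := (Fintype.piFinset (preS lo γ)).sigma S
    let f : (Σ _ : Fin (k + 1) → ℤ, ℕ → Fin (k + 1) → ℤ) → ℕ → Fin (k + 1) → ℤ :=
      fun p m => if m ≤ n then p.2 m else γ
    have hP : ∀ p ∈ P, (Inter p.1 γ ∧ StrictMono p.1) ∧ IsChain n α p.1 p.2 := by
      intro p hp
      rw [Finset.mem_sigma] at hp
      have h1 := hpre _ hp.1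
      exact ⟨h1, ((hS _ h1.2.monotone).1 _).1 hp.2⟩
    refine ⟨P.image f, fun hγ => ⟨?_, ?_⟩⟩
    · intro K
      rw [Finset.mem_image]
      constructor
      · rintro ⟨p, hp, rfl⟩
        obtain ⟨⟨h1, h2⟩, h3⟩ := hP p hp
        have hsγ : StrictMono γ := fun a b hab => (h1.2 a b hab).trans_le (h1.1 b)
        refine ⟨?_, ?_, ?_, ?_⟩
        · simp only [f, Nat.zero_le, if_true]; exact h3.1
        · intro m hm
          simp only [f]; rw [if_neg (by omega)]
        · intro m
          simp only [f]
          split_ifs with hm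
          · exact h3.2.2.1 m
          · exact hsγ
        · intro m
          simp only [f]
          rcases lt_trichotomy m n with hm | hm | hm
          · rw [if_pos (by omega), if_pos (by omega)]; exact h3.2.2.2 m
          · rw [if_pos (by omega), if_neg (by omega), h3.2.1 m hm.ge]; exact h1
          · rw [if_neg (by omega), if_neg (by omega)]; exact ⟨fun _ => le_rfl, fun a b hab => hsγ hab⟩
      · intro hK
        have hmono : ∀ a, α a ≤ K n a := fun a => by
          have := monotone_nat_of_le_succ (f := fun m => K m a) (fun m => (hK.2.2.2 m).1 a) (Nat.zero_le n)
          simp only [hK.1] at this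
          exact this
        have e1 := hK.2.1 (n + 1) le_rfl
        have hI := hK.2.2.2 n
        rw [e1] at hI
        have hs := hK.2.2.1 n
        refine ⟨⟨K n, fun m => if m ≤ n then K m else K n⟩, ?_, ?_⟩
        · rw [Finset.mem_sigma]
          constructor
          · rw [Fintype.mem_piFinset]
            intro a
            rw [preS, Finset.mem_Ioc]
            refine ⟨?_, hI.1 a⟩
            refine Fin.cases ?_ (fun i => ?_) a
            · have q1 := hlo 0
              have q2 := hmono 0
              simp only [Fin.cases_zero]
              omega
            · simp only [Fin.cases_succ]
              exact hI.2 _ _ i.castSucc_lt_succ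
          · rw [(hS _ hs.monotone).1]
            refine ⟨?_, ?_, ?_, ?_⟩
            · simp [hK.1]
            · intro m hm
              simp only
              split_ifs with h
              · rw [le_antisymm h hm]
              · rfl
            · intro m
              simp only
              split_ifs with h
              · exact hK.2.2.1 m
              · exact hs
            · intro m
              simp only
              rcases lt_or_ge m n with hm | hm
              · rw [if_pos (by omega), if_pos (by omega)]; exact hK.2.2.2 m
              · have : (if m ≤ n then K m else K n) = K n := by
                  split_ifs with h
                  · rw [le_antisymm h hm]
                  · rfl
                rw [this, if_neg (by omega)]
                exact ⟨fun _ => le_rfl, fun a b hab => hs hab⟩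
        · funext m
          simp only [f]
          split_ifs with h
          · rfl
          · exact (hK.2.1 m (by omega)).symm
    · rw [det_step x n lo α γ hlo hγ, Finset.sum_image]
      · rw [Finset.sum_sigma]
        refine Finset.sum_congr rfl fun β hβ => ?_
        have h1 := hpre β hβ
        rw [(hS β h1.2.monotone).2, Finset.mul_sum]
        refine Finset.sum_congr rfl fun K hK => ?_
        have hc := ((hS β h1.2.monotone).1 K).1 hK
        rw [wtx, wtx, Finset.prod_range_succ, mul_comm]
        congr 1
        · refine Finset.prod_congr rfl fun m hm => ?_
          rw [Finset.mem_range] at hm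
          simp only [f]
          rw [if_pos (by omega), if_pos (by omega)]
        · simp only [f]
          rw [if_pos le_rfl, if_neg (by omega), hc.2.1 n le_rfl, Finset.prod_pow_eq_pow_sum,
            ← Finset.sum_sub_distrib]
          congr 1
          have : ((∑ a, (γ a - β a).toNat : ℕ) : ℤ) = ∑ a, (γ a - β a) := by
            push_cast
            refine Finset.sum_congr rfl fun a _ => ?_
            have := h1.1.1 a
            omega
          omega
      · intro p hp q hq hpq
        obtain ⟨-, h3⟩ := hP p hp
        obtain ⟨-, h3'⟩ := hP q hq
        have hK : ∀ m ≤ n, p.2 m = q.2 m := by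
          intro m hm
          have := congrFun hpq m
          simp only [f, if_pos hm] at this
          exact this
        have hb : p.1 = q.1 := by
          rw [← h3.2.1 n le_rfl, ← h3'.2.1 n le_rfl]; exact hK n le_rfl
        obtain ⟨β, K⟩ := p
        obtain ⟨β', K'⟩ := q
        simp only at hb hK h3 h3'
        subst hb
        congr 1
        funext m
        rcases le_total m n with h | h
        · exact hK m h
        · rw [h3.2.1 m h, h3'.2.1 m h]
end
end JT

namespace JT
open Finset
section
open MvPolynomial

noncomputable def PF (N : ℕ) : PowerSeries (MvPolynomial (Fin N) ℤ) :=
  ∏ i : Fin N, PowerSeries.mk (fun j => (X i : MvPolynomial (Fin N) ℤ) ^ j)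

lemma homog_eq (N : ℕ) (m : ℤ) : homog N m = if 0 ≤ m then PowerSeries.coeff m.toNat (PF N) else 0 := by
  rw [homog, PF, hsymm_eq_coeff]

noncomputable def xv (N : ℕ) (m : ℕ) : MvPolynomial (Fin N) ℤ := if h : m < N then X ⟨m, h⟩ else 0

lemma homog_eq_Hh (N : ℕ) (m : ℤ) : homog N m = Hh (xv N) N m := by
  rw [homog_eq, Hh, PF, PSn, Finset.prod_range]
  simp [xv]

noncomputable def alt {N : ℕ} (v : Fin N → ℕ) : MvPolynomial (Fin N) ℤ :=
  Matrix.det (Matrix.of fun i j : Fin N => (X i : MvPolynomial (Fin N) ℤ) ^ v j)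

lemma alt_comp {N : ℕ} (v : Fin N → ℕ) (σ : Equiv.Perm (Fin N)) :
    alt (v ∘ σ) = Equiv.Perm.sign σ * alt v := by
  exact Matrix.det_permute' σ (Matrix.of fun i j : Fin N => (X i : MvPolynomial (Fin N) ℤ) ^ v j)

lemma alt_swap {N : ℕ} (v v' : Fin N → ℕ) (i j : Fin N) (hij : i ≠ j) (h1 : v' i = v j) (h2 : v' j = v i)
    (h3 : ∀ l, l ≠ i → l ≠ j → v' l = v l) : alt v' = - alt v := by
  have : v' = v ∘ Equiv.swap i j := by
    funext l
    simp only [Function.comp]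
    by_cases hi : l = i
    · subst hi; simp [h1]
    · by_cases hj : l = j
      · subst hj; simp [h2]
      · rw [Equiv.swap_apply_of_ne_of_ne hi hj, h3 l hi hj]
  rw [this, alt_comp, Equiv.Perm.sign_swap hij]; simp

lemma alt_mul {N : ℕ} {ι : Type*} (F : MvPolynomial (Fin N) ℤ) (hF : F.IsSymmetric) (S : Finset ι)
    (w : ι → Fin N → ℕ) (h : F = ∑ T ∈ S, ∏ i, X i ^ w T i) (v : Fin N → ℕ) :
    alt v * F = ∑ T ∈ S, alt (v + w T) := by
  simp only [alt, Matrix.det_apply, Matrix.of_apply, Pi.add_apply]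
  rw [Finset.sum_mul, Finset.sum_comm]
  refine Finset.sum_congr rfl fun σ _ => ?_
  have e : F = ∑ T ∈ S, ∏ i, X (σ i) ^ w T i := by
    conv_lhs => rw [← hF σ, h]
    simp [map_sum, map_prod]
  rw [smul_mul_assoc]
  conv_lhs => rw [e]
  rw [Finset.mul_sum, Finset.smul_sum]
  refine Finset.sum_congr rfl fun T _ => ?_
  rw [← Finset.prod_mul_distrib]
  simp only [pow_add]

lemma coeff_alt {N : ℕ} (u v : Fin N → ℕ) (hu : StrictAnti u) (hv : StrictAnti v) :
    coeff (Finsupp.equivFunOnFinite.symm u) (alt v) = if u = v then 1 else 0 := by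
  classical
  rw [alt, Matrix.det_apply, coeff_sum]
  have e : ∀ σ : Equiv.Perm (Fin N), coeff (Finsupp.equivFunOnFinite.symm u)
      (Equiv.Perm.sign σ • ∏ i, (Matrix.of fun i j : Fin N => (X i : MvPolynomial (Fin N) ℤ) ^ v j) (σ i) i)
      = if σ = 1 then (if u = v then 1 else 0) else 0 := by
    intro σ
    have e1 : (∏ i, (Matrix.of fun i j : Fin N => (X i : MvPolynomial (Fin N) ℤ) ^ v j) (σ i) i)
        = monomial (Finsupp.equivFunOnFinite.symm (v ∘ σ.symm)) (1 : ℤ) := by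
      rw [monomial_eq, Finsupp.prod_fintype _ _ (fun _ => pow_zero _)]
      simp only [map_one, one_mul, Finsupp.equivFunOnFinite_symm_apply_apply, Function.comp, Matrix.of_apply]
      rw [← Equiv.prod_comp σ fun i => (X i : MvPolynomial (Fin N) ℤ) ^ v (σ.symm i)]
      simp
    rw [e1]
    have e2 : coeff (Finsupp.equivFunOnFinite.symm u) (Equiv.Perm.sign σ • monomial (Finsupp.equivFunOnFinite.symm (v ∘ σ.symm)) (1 : ℤ))
       = (Equiv.Perm.sign σ : ℤ) * if v ∘ σ.symm = u then 1 else 0 := by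
      rw [Units.smul_def, coeff_smul, coeff_monomial]
      simp
    rw [e2]
    by_cases h : v ∘ σ.symm = u
    · have hs : StrictMono σ.symm := by
        intro a b hab
        have := hu hab
        rw [← h] at this
        simp only [Function.comp] at this
        exact hv.lt_iff_gt.1 this
      have h1 : ⇑σ.symm = id := (StrictMono.range_inj hs strictMono_id).1 (by simp [Set.range_id, σ.symm.surjective.range_eq])
      have h2 : σ = 1 := by
        have : σ.symm = 1 := Equiv.ext (fun x => congrFun h1 x)
        rw [← Equiv.symm_symm σ, this]; rfl
      subst h2
      have h3 : u = v := by rw [← h]; rfl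
      rw [if_pos h, if_pos rfl, if_pos h3]
      simp
    · rw [if_neg h]
      split_ifs with h1 h2
      · subst h1 h2
        exact absurd rfl h
      · simp
      · simp
  rw [Finset.sum_congr rfl fun σ _ => e σ]
  simp

def dl (N : ℕ) (i : Fin N) : ℕ := N - 1 - i

noncomputable def Ql (N : ℕ) (l : Fin N) : Polynomial (MvPolynomial (Fin N) ℤ) :=
  ∏ i ∈ Finset.univ.erase l, (1 - Polynomial.C (X i) * Polynomial.X)

lemma Ql_coeff (N : ℕ) (l : Fin N) (j : ℕ) (hj : N ≤ j) : (Ql N l).coeff j = 0 := by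
  apply Polynomial.coeff_eq_zero_of_natDegree_lt
  have h1 : (Ql N l).natDegree ≤ ∑ i ∈ Finset.univ.erase l, 1 := by
    refine (Polynomial.natDegree_prod_le _ _).trans (Finset.sum_le_sum fun i _ => ?_)
    compute_degree
  simp at h1
  have := l.2
  omega

lemma PF_Ql (N : ℕ) (l : Fin N) : (Ql N l : PowerSeries (MvPolynomial (Fin N) ℤ)) * PF N = PowerSeries.mk (fun j => (X l) ^ j) := by
  have e : (Ql N l : PowerSeries (MvPolynomial (Fin N) ℤ)) =
      ∏ i ∈ Finset.univ.erase l, (1 - PowerSeries.C (X i) * PowerSeries.X) := by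
    rw [← Polynomial.coeToPowerSeries.ringHom_apply, Ql, map_prod]
    simp
  rw [e, PF, ← Finset.mul_prod_erase _ _ (Finset.mem_univ l), mul_left_comm, ← Finset.prod_mul_distrib,
    Finset.prod_congr rfl fun i _ => geom_mul (X i)]
  simp

lemma pow_eq (N : ℕ) (l : Fin N) (m : ℕ) :
    (X l : MvPolynomial (Fin N) ℤ) ^ m = ∑ j : Fin N, homog N ((m : ℤ) - dl N j) * (Ql N l).coeff (dl N j) := by
  have h := congrArg (PowerSeries.coeff m) (PF_Ql N l)
  rw [PowerSeries.coeff_mk, PowerSeries.coeff_mul, Finset.Nat.sum_antidiagonal_eq_sum_range_succ_mk] at h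
  rw [← h]
  have e2 : ∑ j : Fin N, homog N ((m : ℤ) - dl N j) * (Ql N l).coeff (dl N j) =
      ∑ j ∈ Finset.range N, (Ql N l).coeff j * homog N ((m : ℤ) - j) := by
    rw [← Finset.sum_range_reflect, Finset.sum_range]
    refine Finset.sum_congr rfl fun j _ => ?_
    rw [dl, mul_comm]
  rw [e2]
  have a1 : ∑ j ∈ Finset.range N, (Ql N l).coeff j * homog N ((m : ℤ) - j) =
      ∑ j ∈ Finset.range (N + (m + 1)), (Ql N l).coeff j * homog N ((m : ℤ) - j) := by
    refine Finset.sum_subset (by simp) fun j _ hj => ?_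
    rw [Ql_coeff N l j (by simpa using hj), zero_mul]
  have a2 : ∑ j ∈ Finset.range (m + 1), (Ql N l).coeff j * homog N ((m : ℤ) - j) =
      ∑ j ∈ Finset.range (N + (m + 1)), (Ql N l).coeff j * homog N ((m : ℤ) - j) := by
    refine Finset.sum_subset (by simp) fun j _ hj => ?_
    rw [homog, if_neg (by simp at hj; omega), mul_zero]
  rw [a1, ← a2]
  refine Finset.sum_congr rfl fun j hj => ?_
  rw [Finset.mem_range] at hj
  simp only [Polynomial.coeff_coe]
  rw [homog_eq, if_pos (by omega), show ((m : ℤ) - j).toNat = m - j by omega]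

lemma bialt (N : ℕ) (lam : ℕ → ℕ) :
    alt (dl N) * skewSchur N N lam (fun _ => 0) = alt (fun i : Fin N => lam i + dl N i) := by
  have key : ∀ lam : ℕ → ℕ, alt (fun i : Fin N => lam i + dl N i) = skewSchur N N lam (fun _ => 0) *
      Matrix.det (Matrix.of fun j l : Fin N => (Ql N l).coeff (dl N j)) := by
    intro lam
    rw [skewSchur, ← Matrix.det_mul, alt, ← Matrix.det_transpose]
    congr 1
    ext1 i l
    rw [Matrix.transpose_apply, Matrix.of_apply, Matrix.mul_apply, pow_eq]
    refine Finset.sum_congr rfl fun j _ => ?_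
    simp only [Matrix.of_apply]
    congr 2
    simp only [dl]
    have := i.2
    have := j.2
    push_cast
    omega
  have h0 : skewSchur N N (fun _ => 0) (fun _ => 0) = 1 := by
    rw [skewSchur, Matrix.det_of_isUpperTriangular]
    · refine Finset.prod_eq_one fun i _ => ?_
      simp [homog]
    · intro i j hij
      simp only [id] at hij
      rw [Matrix.of_apply, homog, if_neg]
      have : (j : ℕ) < i := hij
      push_cast
      omega
  have k0 := key (fun _ => 0)
  rw [h0, one_mul] at k0
  rw [key lam, ← k0, mul_comm]
  congr 2
  funext i
  simp

lemma dl_anti (N : ℕ) : StrictAnti (dl N) := by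
  intro i j hij
  have : (i : ℕ) < j := hij
  have := j.2
  simp only [dl]
  omega

lemma alt_dl_ne (N : ℕ) : alt (dl N) ≠ 0 := by
  intro h
  have := coeff_alt (dl N) (dl N) (dl_anti N) (dl_anti N)
  rw [h] at this
  simp at this

lemma homog_symm (N : ℕ) (m : ℤ) (e : Equiv.Perm (Fin N)) : rename e (homog N m) = homog N m := by
  rw [homog]
  split_ifs
  · exact hsymm_isSymmetric _ _ _ e
  · simp

lemma det_homog_symm (N k : ℕ) (f : Fin k → Fin k → ℤ) :
    (Matrix.det (Matrix.of fun a b => homog N (f a b))).IsSymmetric := by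
  intro e
  rw [AlgHom.map_det]
  congr 1
  ext1 a b
  simp [homog_symm]
end
end JT

namespace JT
open Finset
section
open MvPolynomial

def ext0 {N : ℕ} (u : Fin N → ℕ) (j : ℕ) : ℕ := if h : j < N then u ⟨j, h⟩ else 0

lemma schur_of_alt {N : ℕ} {ι : Type*} (P : MvPolynomial (Fin N) ℤ) (n : ℕ) (S : Finset ι) (g : ι → ℕ)
    (w : ι → Fin N → ℕ) (hw : ∀ T ∈ S, g T ≠ 0 → Antitone (w T))
    (h : 2 ^ n • (alt (dl N) * P) = ∑ T ∈ S, g T • alt (dl N + w T)) : IsSchurNonneg N P := by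
  classical
  let pt := (S.filter fun T => g T ≠ 0).image w
  let M : (Fin N → ℕ) → ℕ := fun u => ∑ T ∈ (S.filter fun T => g T ≠ 0).filter (fun T => w T = u), g T
  have hpt : ∀ u ∈ pt, Antitone u := by
    intro u hu
    obtain ⟨T, hT, rfl⟩ := Finset.mem_image.1 hu
    rw [Finset.mem_filter] at hT
    exact hw T hT.1 hT.2
  have hst : ∀ u ∈ pt, StrictAnti (dl N + u) := fun u hu => (dl_anti N).add_antitone (hpt u hu)
  have h1 : 2 ^ n • (alt (dl N) * P) = ∑ u ∈ pt, M u • alt (dl N + u) := by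
    rw [h]
    have e1 : ∑ T ∈ S, g T • alt (dl N + w T) = ∑ T ∈ S.filter (fun T => g T ≠ 0), g T • alt (dl N + w T) := by
      rw [Finset.sum_filter_of_ne]
      intro T _ hne h0
      rw [h0, zero_smul] at hne
      exact hne rfl
    rw [e1, ← Finset.sum_fiberwise_of_maps_to (t := pt) (g := w) (fun T hT => Finset.mem_image_of_mem w hT)]
    refine Finset.sum_congr rfl fun u _ => ?_
    simp only [M]
    rw [Finset.sum_smul]
    refine Finset.sum_congr rfl fun T hT => ?_
    rw [(Finset.mem_filter.1 hT).2]
  have h2 : ∀ u ∈ pt, 2 ^ n * coeff (Finsupp.equivFunOnFinite.symm (dl N + u)) (alt (dl N) * P) = (M u : ℤ) := by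
    intro u hu
    have := congrArg (coeff (Finsupp.equivFunOnFinite.symm (dl N + u))) h1
    rw [coeff_sum, coeff_smul] at this
    have e : ∀ u' ∈ pt, coeff (Finsupp.equivFunOnFinite.symm (dl N + u)) (M u' • alt (dl N + u')) =
        if u = u' then (M u' : ℤ) else 0 := by
      intro u' hu'
      rw [coeff_smul, coeff_alt _ _ (hst u hu) (hst u' hu')]
      by_cases he : u = u'
      · simp [he]
      · simp [he]
    rw [Finset.sum_congr rfl e, Finset.sum_ite_eq, if_pos hu] at this
    rw [← this, nsmul_eq_mul]
    push_cast
    rfl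
  let c : (Fin N → ℕ) → ℕ := fun u => (coeff (Finsupp.equivFunOnFinite.symm (dl N + u)) (alt (dl N) * P)).toNat
  have h3 : ∀ u ∈ pt, M u = 2 ^ n * c u := by
    intro u hu
    have := h2 u hu
    have hp : (0 : ℤ) < 2 ^ n := by positivity
    have hn : 0 ≤ coeff (Finsupp.equivFunOnFinite.symm (dl N + u)) (alt (dl N) * P) := by
      by_contra hneg
      have hx := mul_neg_of_pos_of_neg hp (not_le.1 hneg)
      rw [this] at hx
      have : (0 : ℤ) ≤ M u := by positivity
      omega
    zify
    rw [← this]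
    simp only [c]
    rw [Int.toNat_of_nonneg hn]
  have h4 : P = ∑ u ∈ pt, (c u : ℤ) • skewSchur N N (ext0 u) (fun _ => 0) := by
    have hb : ∀ u, alt (dl N + u) = alt (dl N) * skewSchur N N (ext0 u) (fun _ => 0) := by
      intro u
      rw [bialt]
      congr 1
      funext i
      simp [ext0, add_comm]
    apply mul_left_cancel₀ (alt_dl_ne N)
    have hz : (2 ^ n : ℕ) ≠ 0 := by positivity
    apply smul_right_injective _ hz
    simp only
    rw [h1, Finset.mul_sum, Finset.smul_sum]
    refine Finset.sum_congr rfl fun u hu => ?_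
    rw [h3 u hu, hb, mul_smul]
    congr 1
    rw [mul_smul_comm]
    simp
  refine ⟨pt.card, fun i => c (pt.equivFin.symm i).1, fun _ => N, fun i => ext0 (pt.equivFin.symm i).1, ?_, ?_, ?_⟩
  · intro i a b hab
    have := hpt _ (pt.equivFin.symm i).2
    simp only [ext0]
    split_ifs with hb ha
    · exact this (by simpa using hab)
    · omega
    · omega
    · omega
  · intro i j hj
    simp only at hj
    simp only [ext0]
    rw [dif_neg (by omega)]
  · rw [Equiv.sum_comp pt.equivFin.symm fun u => (c u.1 : ℤ) • skewSchur N N (ext0 u.1) (fun _ => 0)]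
    rw [h4]
    conv_lhs => rw [← Finset.sum_coe_sort]

variable {k : ℕ}

noncomputable def wT (N : ℕ) (T : Bool → ℕ → Fin (k + 1) → ℤ) (i : Fin N) : ℕ := (tot T (i + 1) - tot T i).toNat

noncomputable def DD (N : ℕ) (α γ : Bool → Fin (k + 1) → ℤ) : MvPolynomial (Fin N) ℤ :=
  ∏ c : Bool, Matrix.det (Matrix.of fun a b => homog N (γ c a - α c b))

lemma PC.sum_le {N : ℕ} {α γ : Bool → Fin (k + 1) → ℤ} {T : Bool → ℕ → Fin (k + 1) → ℤ}
    (h : PC N α γ T) (c : Bool) (m : ℕ) : ∑ a, T c m a ≤ ∑ a, T c (m + 1) a :=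
  Finset.sum_le_sum fun a _ => h.le c (Nat.le_succ m) a

lemma PC.tot_le {N : ℕ} {α γ : Bool → Fin (k + 1) → ℤ} {T : Bool → ℕ → Fin (k + 1) → ℤ}
    (h : PC N α γ T) (m : ℕ) : tot T m ≤ tot T (m + 1) := by
  have h1 := h.sum_le true m
  have h2 := h.sum_le false m
  simp only [tot]
  omega

lemma DD_eq (N : ℕ) (α γ : Bool → Fin (k + 1) → ℤ) (hα : ∀ c, Monotone (α c)) (hγ : ∀ c, Monotone (γ c)) :
    ∃ S : Finset (Bool → ℕ → Fin (k + 1) → ℤ), (∀ T, T ∈ S ↔ PC N α γ T) ∧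
      alt (dl N) * DD N α γ = ∑ T ∈ S, alt (dl N + wT N T) := by
  classical
  choose S hS using fun c => lgv (xv N) (α c) (hα c) N (γ c)
  have hS' := fun c => hS c (hγ c)
  have hmem : ∀ T, T ∈ Fintype.piFinset S ↔ PC N α γ T := by
    intro T
    rw [Fintype.mem_piFinset]
    exact forall_congr' fun c => (hS' c).1 _
  refine ⟨Fintype.piFinset S, hmem, ?_⟩
  refine alt_mul _ ?_ _ _ ?_ _
  · rw [DD, Fintype.prod_bool]
    exact (det_homog_symm _ _ _).mul (det_homog_symm _ _ _)
  · simp only [DD, homog_eq_Hh]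
    rw [Finset.prod_congr rfl fun c _ => (hS' c).2, Finset.prod_univ_sum]
    refine Finset.sum_congr rfl fun T hT => ?_
    have hp := (hmem T).1 hT
    rw [Fintype.prod_bool, wtx, wtx, ← Finset.prod_mul_distrib, Finset.prod_range]
    refine Finset.prod_congr rfl fun i _ => ?_
    rw [← pow_add, xv, dif_pos i.2, wT]
    congr 1
    have h1 := hp.sum_le true i
    have h2 := hp.sum_le false i
    simp only [tot]
    omega

lemma PC.move {N : ℕ} {α γ : Bool → Fin (k + 1) → ℤ} {T : Bool → ℕ → Fin (k + 1) → ℤ}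
    (h : PC N α γ T) (i : ℕ) (hi : i + 1 < N) (z : Bool → ℤ) : PC N α γ (moveZ T i z) := by
  have hv : VT (moveZ T i z) := moveZ_valid h.vt _ _
  intro c
  refine ⟨?_, ?_, fun m => (hv c m).1, fun m => (hv c m).2⟩
  · rw [moveZ_ne _ _ _ _ (by omega)]; exact (h c).1
  · intro m hm
    rw [moveZ_ne _ _ _ _ (by omega)]; exact (h c).2.1 m hm

lemma sum_GG_alt (N : ℕ) (α γ : Bool → Fin (k + 1) → ℤ) (lo hi : ℤ)
    (hhi : ∀ c a, γ c a ≤ hi) (S : Finset (Bool → ℕ → Fin (k + 1) → ℤ)) (hS : ∀ T, T ∈ S ↔ PC N α γ T) :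
    2 ^ (checks N lo hi).card • ∑ T ∈ S, alt (dl N + wT N T) =
      ∑ T ∈ S, GG (checks N lo hi) T • alt (dl N + wT N T) := by
  refine sum_GG N lo hi S (fun T hT => ((hS T).1 hT).vt) (fun T hT => ((hS T).1 hT).hi hhi)
    (fun T hT i hi z => (hS _).2 (((hS T).1 hT).move i hi z)) _ ?_
  intro T hT T' hT' i hi ht he
  rw [hS] at hT hT'
  have l1 := hT.tot_le i
  have l2 := hT.tot_le (i + 1)
  have l3 := hT'.tot_le i
  have l4 := hT'.tot_le (i + 1)
  have t1 := ht i (by omega)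
  have t2 := ht (i + 2) (by omega)
  rw [show i + 1 + 1 = i + 2 by rfl] at l2 l4
  refine alt_swap _ _ ⟨i, by omega⟩ ⟨i + 1, hi⟩ (by simp) ?_ ?_ ?_
  · simp only [Pi.add_apply, dl, wT, show i + 1 + 1 = i + 2 by rfl]
    omega
  · simp only [Pi.add_apply, dl, wT, show i + 1 + 1 = i + 2 by rfl]
    omega
  · intro l h1 h2
    have h1' : (l : ℕ) ≠ i := fun h => h1 (Fin.ext h)
    have h2' : (l : ℕ) ≠ i + 1 := fun h => h2 (Fin.ext h)
    simp only [Pi.add_apply, wT]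
    rw [ht l (by omega), ht (l + 1) (by omega)]

lemma main_succ (N : ℕ) (α γ : Bool → Fin (k + 1) → ℤ) (hα : ∀ c, Monotone (α c)) (hγ : ∀ c, Monotone (γ c)) :
    IsSchurNonneg N (DD N (up α) (up γ) - DD N α γ) := by
  classical
  have hup : ∀ β : Bool → Fin (k + 1) → ℤ, (∀ c, Monotone (β c)) → ∀ c, Monotone (up β c) := by
    intro β hβ c a b hab
    have h1 := hβ true hab
    have h2 := hβ false hab
    simp only [up]
    split_ifs
    · exact max_le_max h1 h2
    · exact min_le_min h1 h2
  obtain ⟨lo, hlo⟩ : ∃ lo : ℤ, ∀ c a, lo ≤ α c a := ⟨min (α true 0) (α false 0), fun c a => by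
    have := hα c (Fin.zero_le a)
    cases c
    · exact (min_le_right _ _).trans this
    · exact (min_le_left _ _).trans this⟩
  obtain ⟨hi, hhi, hlh⟩ : ∃ hi : ℤ, (∀ c a, γ c a ≤ hi) ∧ lo < hi :=
    ⟨max (lo + 1) (max (γ true (Fin.last k)) (γ false (Fin.last k))), fun c a => by
      have := hγ c (Fin.le_last a)
      cases c
      · exact this.trans ((le_max_right _ _).trans (le_max_right _ _))
      · exact this.trans ((le_max_left _ _).trans (le_max_right _ _)), by
      have := le_max_left (lo + 1) (max (γ true (Fin.last k)) (γ false (Fin.last k)))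
      omega⟩
  have hlo' : ∀ c a, lo ≤ up α c a := by
    intro c a
    have h1 := hlo true a
    have h2 := hlo false a
    simp only [up]; split_ifs
    · exact le_max_of_le_left h1
    · exact le_min h1 h2
  have hhi' : ∀ c a, up γ c a ≤ hi := by
    intro c a
    have h1 := hhi true a
    have h2 := hhi false a
    simp only [up]; split_ifs
    · exact max_le h1 h2
    · exact min_le_of_left_le h1
  obtain ⟨S, hS, e1⟩ := DD_eq N α γ hα hγ
  obtain ⟨S', hS', e2⟩ := DD_eq N (up α) (up γ) (hup α hα) (hup γ hγ)
  obtain ⟨F, hF, hinj⟩ := exists_injection N α γ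
  have g1 := sum_GG_alt N α γ lo hi hhi S hS
  have g2 := sum_GG_alt N (up α) (up γ) lo hi hhi' S' hS'
  have hsub : S.image F ⊆ S' := by
    intro T hT
    obtain ⟨T0, hT0, rfl⟩ := Finset.mem_image.1 hT
    exact (hS' _).2 (hF T0 ((hS _).1 hT0)).1
  have g3 : ∑ T ∈ S.image F, GG (checks N lo hi) T • alt (dl N + wT N T) =
      ∑ T ∈ S, GG (checks N lo hi) T • alt (dl N + wT N T) := by
    rw [Finset.sum_image fun T hT T' hT' h => hinj T T' ((hS _).1 hT) ((hS _).1 hT') h]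
    refine Finset.sum_congr rfl fun T hT => ?_
    have p := (hS T).1 hT
    obtain ⟨p', hs⟩ := hF T p
    rw [GG_sameS hs p.vt p'.vt (p.hi hhi) (p'.hi hhi')]
    congr 2
    funext i
    simp only [Pi.add_apply, wT]
    rw [tot_sameS hs (p.hi hhi) (p'.hi hhi') (p.lo hlo) (p'.lo hlo'),
      tot_sameS hs (p.hi hhi) (p'.hi hhi') (p.lo hlo) (p'.lo hlo')]
  refine schur_of_alt _ (checks N lo hi).card (S' \ S.image F) (GG (checks N lo hi)) (wT N) ?_ ?_
  · intro T hT hG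
    have p := (hS' T).1 (Finset.mem_sdiff.1 hT).1
    have key : ∀ i, i + 1 < N → (tot T (i + 1 + 1) - tot T (i + 1)).toNat ≤ (tot T (i + 1) - tot T i).toNat := by
      intro i hi
      have := GG_anti p.vt (p.lo hlo') hlh hG hi
      rw [show i + 1 + 1 = i + 2 by rfl]
      omega
    intro i j hij
    simp only [wT]
    obtain ⟨j, hj⟩ := j
    have hij : (i : ℕ) ≤ j := hij
    simp only
    induction j, hij using Nat.le_induction with
    | base => exact le_rfl
    | succ j hle ih => exact (key j hj).trans (ih (by omega) hle)
  · rw [mul_sub, smul_sub, e1, e2, g1, g2, ← g3, ← Finset.sum_sdiff hsub]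
    abel
end
end JT

/-- For `k`-element subsets `I, J, I', J'` of `{1,…,n}` and a generalized
Jacobi–Trudi matrix `X = (h_{μ_i - ν_j})`, we have
`Δ_{I∨I', J∨J'}(X) Δ_{I∧I', J∧J'}(X) ≥_s Δ_{I,J}(X) Δ_{I',J'}(X)`.
Here `I ∨ J = {max(i_1,j_1) < … < max(i_k,j_k)}` and
`I ∧ J = {min(i_1,j_1) < … < min(i_k,j_k)}` in terms of the increasing
enumerations `I = {i_1 < … < i_k}`, `J = {j_1 < … < j_k}`. -/
theorem jtMinor_vee_wedge_schur_nonneg (n k : ℕ) (mu nu : ℕ → ℕ)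
    (hmu : Antitone mu) (hnu : Antitone nu)
    (I J I' J' : Finset (Fin n))
    (hI : I.card = k) (hJ : J.card = k) (hI' : I'.card = k) (hJ' : J'.card = k)
    (N : ℕ) :
    IsSchurNonneg N
      (jtMinor N n mu nu k
          (fun a => max (I.orderIsoOfFin hI a) (I'.orderIsoOfFin hI' a))
          (fun a => max (J.orderIsoOfFin hJ a) (J'.orderIsoOfFin hJ' a))
        * jtMinor N n mu nu k
          (fun a => min (I.orderIsoOfFin hI a) (I'.orderIsoOfFin hI' a))
          (fun a => min (J.orderIsoOfFin hJ a) (J'.orderIsoOfFin hJ' a))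
        - jtMinor N n mu nu k (fun a => I.orderIsoOfFin hI a) (fun a => J.orderIsoOfFin hJ a)
          * jtMinor N n mu nu k (fun a => I'.orderIsoOfFin hI' a)
            (fun a => J'.orderIsoOfFin hJ' a)) := by
  obtain _ | k := k
  · refine ⟨0, Fin.elim0, Fin.elim0, Fin.elim0, fun i => i.elim0, fun i => i.elim0, ?_⟩
    simp [jtMinor]
  · let mk : (ℕ → ℕ) → (Fin (k + 1) → Fin n) → Fin (k + 1) → ℤ := fun f r a => (f (r (Fin.rev a)) : ℤ)
    have hdet : ∀ r c : Fin (k + 1) → Fin n, jtMinor N n mu nu (k + 1) r c =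
        Matrix.det (Matrix.of fun a b => homog N (mk mu r a - mk nu c b)) := by
      intro r c
      rw [jtMinor, ← Matrix.det_submatrix_equiv_self Fin.revPerm]
      rfl
    have hmono : ∀ f : ℕ → ℕ, Antitone f → ∀ r : Fin (k + 1) → Fin n, Monotone r → Monotone (mk f r) := by
      intro f hf r hr a b hab
      exact Int.ofNat_le.2 (hf (hr (Fin.rev_le_rev.2 hab)))
    have hord : ∀ (A : Finset (Fin n)) (hA : A.card = k + 1), Monotone (fun a => (A.orderIsoOfFin hA a : Fin n)) :=
      fun A hA a b hab => (A.orderIsoOfFin hA).monotone hab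
    let al : Bool → Fin (k + 1) → ℤ := fun c => if c then mk nu (fun a => J.orderIsoOfFin hJ a) else mk nu (fun a => J'.orderIsoOfFin hJ' a)
    let ga : Bool → Fin (k + 1) → ℤ := fun c => if c then mk mu (fun a => I.orderIsoOfFin hI a) else mk mu (fun a => I'.orderIsoOfFin hI' a)
    have hmax : ∀ f : ℕ → ℕ, Antitone f → ∀ a b : Fin n, (f ((max a b : Fin n) : ℕ) : ℤ) = min (f a : ℤ) (f b : ℤ) := by
      intro f hf a b
      have := hf.map_max (a := (a : ℕ)) (b := (b : ℕ))
      rw [Fin.coe_max, this]; push_cast; rfl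
    have hmin : ∀ f : ℕ → ℕ, Antitone f → ∀ a b : Fin n, (f ((min a b : Fin n) : ℕ) : ℤ) = max (f a : ℤ) (f b : ℤ) := by
      intro f hf a b
      have := hf.map_min (a := (a : ℕ)) (b := (b : ℕ))
      rw [Fin.coe_min, this]; push_cast; rfl
    have main := JT.main_succ N al ga ?_ ?_
    · rw [hdet, hdet, hdet, hdet]
      simp only [JT.DD, Fintype.prod_bool] at main
      rw [mul_comm (Matrix.det _)]
      convert main using 4
      · congr 2
        funext a b
        simp [mk, JT.up, al, ga, hmin mu hmu, hmin nu hnu]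
      · congr 2
        funext a b
        simp [mk, JT.up, al, ga, hmax mu hmu, hmax nu hnu]
      · simp [al, ga]
      · simp [al, ga]
    · intro c
      cases c
      · exact hmono nu hnu _ (hord J' hJ')
      · exact hmono nu hnu _ (hord J hJ)
    · intro c
      cases c
      · exact hmono mu hmu _ (hord I' hI')
      · exact hmono mu hmu _ (hord I hI)
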